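/- For all non-negative integers a, b with 2a + b = 114, the system L_3(17; 4^{×a}, 3^{×b}) is non-special of virtual dimension −1; that is, there exist a + b pairwise linearly independent points in ℚ^4 \ {0} such that the only homogeneous polynomial of degree 17 in 4 variables over ℚ vanishing to order ≥ 4 at the first a points and ≥ 3 at the remaining b points is the zero polynomial, and indeed C(20,3) − 20a − 10b − 1 = 1140 − 10(2a+b) − 1 = −1. -/

import Mathlib

open MvPolynomial

/-- The differential operator `∂₀^{ν 0} ∂₁^{ν 1} ∂₂^{ν 2} ∂₃^{ν 3}` on polynomials
in 4 variables over `ℚ`. -/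
noncomputable def diffOp (ν : Fin 4 → ℕ) :
    Module.End ℚ (MvPolynomial (Fin 4) ℚ) :=
  ((pderiv (0 : Fin 4)).toLinearMap ^ ν 0) * ((pderiv (1 : Fin 4)).toLinearMap ^ ν 1) *
    ((pderiv (2 : Fin 4)).toLinearMap ^ ν 2) * ((pderiv (3 : Fin 4)).toLinearMap ^ ν 3)

/-- Polynomials all of whose partial derivatives of order `< m` (including order 0)
vanish at the point `pt : ℚ⁴`. -/
noncomputable def vanishingSpace (m : ℕ) (pt : Fin 4 → ℚ) :
    Submodule ℚ (MvPolynomial (Fin 4) ℚ) :=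
  ⨅ (ν : Fin 4 → ℕ) (_ : ∑ j, ν j < m),
    LinearMap.ker ((aeval pt).toLinearMap ∘ₗ
      (diffOp ν : MvPolynomial (Fin 4) ℚ →ₗ[ℚ] MvPolynomial (Fin 4) ℚ))

/-- `V(d; m_1,…,m_r; p_1,…,p_r)`: homogeneous polynomials of degree `d` in 4 variables
over `ℚ` vanishing to order `≥ ms[i]` at `pts i` for each `i`. -/
noncomputable def systemSpace (d : ℕ) (ms : List ℕ) (pts : Fin ms.length → Fin 4 → ℚ) :
    Submodule ℚ (MvPolynomial (Fin 4) ℚ) :=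
  homogeneousSubmodule (Fin 4) ℚ d ⊓ ⨅ i, vanishingSpace (ms.get i) (pts i)

/-- The virtual dimension `vdim L_3(d; m_1,…,m_r) = C(d+3,3) − Σ C(m_i+2,3) − 1`. -/
def vdim (d : ℕ) (ms : List ℕ) : ℤ :=
  ((d + 3).choose 3 : ℤ) - (ms.map fun m => ((m + 2).choose 3 : ℤ)).sum - 1

/-- The linear system `L_3(d; m_1,…,m_r)` is non-special: there exist pairwise linearly
independent points of `ℚ⁴ \ {0}` at which the space of degree-`d` homogeneous polynomials
with the prescribed multiplicities has dimension `max (vdim + 1) 0`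
(the expected dimension). -/
noncomputable def nonSpecial (d : ℕ) (ms : List ℕ) : Prop :=
  ∃ pts : Fin ms.length → Fin 4 → ℚ,
    (∀ i, pts i ≠ 0) ∧
    (∀ i j, i ≠ j → LinearIndependent ℚ ![pts i, pts j]) ∧
    (Module.finrank ℚ (systemSpace d ms pts) : ℤ) = max (vdim d ms + 1) 0

/-- Exponent vectors in four variables (also used for weight vectors). -/
structure P4 where
  x : ℕ
  y : ℕ
  z : ℕ
  t : ℕ

noncomputable instance instDecidableEqP4 : DecidableEq P4 := Classical.decEq _

/-- Evaluate a natural number before passing it on (helps kernel reduction). -/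
noncomputable def forceNat {α : Type} (n : ℕ) (k : ℕ → α) : α :=
  Nat.rec (motive := fun _ => α) (k 0) (fun n _ => k (Nat.succ n)) n

/-- The packing base `7 ^ 68`. -/
def base : ℕ := 2928644930813641516032715844013695341634232321209103400801

/-- Half of the packing base. -/
def halfBase : ℕ := 1464322465406820758016357922006847670817116160604551700400

/-- A row of the elimination: packed values, together with a bound for the digits. -/
abbrev Row := ℕ × ℕ

/-- The combination `A * s - B * r` or `A * s + B * r` modulo `N`, shifted by one digit. -/
noncomputable def combRow (N e d : ℕ) (sgn : Bool) (rR rc sR sc : ℕ) : Option Row :=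
  forceNat (Nat.gcd e d) fun g => forceNat (Nat.div e g) fun A => forceNat (Nat.div d g) fun B =>
    forceNat (Nat.add (Nat.mul A sc) (Nat.mul B rc)) fun c =>
      bif Nat.ble c halfBase then
        forceNat (Nat.div (Nat.mod (Nat.add (Nat.mul A sR)
          (Nat.mul B (bif sgn then Nat.sub N rR else rR))) N) base) fun R => some (R, c)
      else none

/-- Eliminate the last digit of `s` using the pivot row `r` with last digit `± e`. -/
noncomputable def reduceRow (N e : ℕ) (neg : Bool) (rR rc sR sc : ℕ) : Option Row :=
  forceNat (Nat.mod sR base) fun d =>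
    bif Nat.beq d 0 then forceNat (Nat.div sR base) fun R => some (R, sc) else
      bif Nat.ble d halfBase then combRow N e d (not neg) rR rc sR sc
      else forceNat (Nat.sub base d) fun d' => combRow N e d' neg rR rc sR sc

/-- Apply `reduceRow` to all rows. -/
noncomputable def reduceAll (N e : ℕ) (neg : Bool) (rR rc : ℕ) (rs : List Row) :
    Option (List Row) :=
  List.rec (motive := fun _ => Option (List Row)) (some [])
    (fun s _ ih => Prod.rec (motive := fun _ => Option (List Row)) (fun sR sc =>
      Option.rec (motive := fun _ => Option (List Row)) none
      (fun s' => Option.rec (motive := fun _ => Option (List Row)) none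
        (fun l => some (s' :: l)) ih) (reduceRow N e neg rR rc sR sc)) s) rs

/-- Handle one column: the flag tells whether a pivot was found. -/
noncomputable def scanRows (N : ℕ) (rs : List Row) : Option (Bool × List Row) :=
  List.rec (motive := fun _ => Option (Bool × List Row)) (some (false, []))
    (fun r rs ih => Prod.rec (motive := fun _ => Option (Bool × List Row)) (fun rR rc =>
      forceNat (Nat.mod rR base) fun d =>
      bif Nat.beq d 0 then
        forceNat (Nat.div rR base) fun R =>
          Option.rec (motive := fun _ => Option (Bool × List Row)) none
            (fun p => Prod.rec (motive := fun _ => Option (Bool × List Row))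
              (fun f l => some (f, (R, rc) :: l)) p) ih
      else
        Option.rec (motive := fun _ => Option (Bool × List Row)) none
          (fun l => some (true, l))
          (bif Nat.ble d halfBase then reduceAll N d false rR rc rs
            else forceNat (Nat.sub base d) fun d' => reduceAll N d' true rR rc rs)) r) rs

/-- Handle one column of rows with `n + 1` digits. -/
noncomputable def scanPow (n : ℕ) (rows : List Row) : Option (Bool × List Row) :=
  forceNat (Nat.pow base (Nat.succ n)) fun N => scanRows N rows

/-- Elimination; returns the points without pivot. -/
noncomputable def elimStep (scan : ℕ → List Row → Option (Bool × List Row)) (n : ℕ) : List P4 → List Row → Option (List P4) :=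
  Nat.rec (motive := fun _ => List P4 → List Row → Option (List P4))
    (fun P rows => List.rec (motive := fun _ => Option (List P4)) (some P) (fun _ _ _ => none) rows)
    (fun n ih P rows => List.rec (motive := fun _ => Option (List P4)) (some P)
      (fun _ _ _ => List.rec (motive := fun _ => Option (List P4)) none
        (fun β P _ => Option.rec (motive := fun _ => Option (List P4)) none
          (fun p => Prod.rec (motive := fun _ => Option (List P4)) (fun f rows' =>
            Bool.rec (motive := fun _ => Option (List P4))
              (Option.rec (motive := fun _ => Option (List P4)) none (fun l => some (β :: l))
                (ih P rows'))
              (ih P rows') f) p)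
          (scan n rows)) P) rows) n

/-- Pack the values of `f` at the first `n` points of `P`. -/
noncomputable def packNat (f : P4 → ℕ) (n : ℕ) : List P4 → ℕ :=
  Nat.rec (motive := fun _ => List P4 → ℕ) (fun _ => 0)
    (fun _ ih P => List.rec (motive := fun _ => ℕ) 0
      (fun β P _ => Nat.add (f β) (Nat.mul base (ih P))) P) n

/-- The initial rows. -/
noncomputable def initRows (n : ℕ) (P : List P4) (fs : List (P4 → ℕ)) : List Row :=
  List.rec (motive := fun _ => List Row) []
    (fun f _ ih => forceNat (packNat f n P) fun v => (v, 5000) :: ih) fs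

/-- `k` elimination steps, looking at the first `n` points each time. -/
noncomputable def chain (fs : List (P4 → ℕ)) (n k : ℕ) : List P4 → Option (List P4) :=
  Nat.rec (motive := fun _ => List P4 → Option (List P4)) (fun P => some P)
    (fun _ ih P => Option.rec (motive := fun _ => Option (List P4)) none
      (fun P' => ih P') (elimStep scanPow n P (initRows n P fs))) k

/-- Falling factorials of order at most two. -/
def fs3 : List (P4 → ℕ) :=
  [fun _ => 1, fun b => b.x, fun b => b.y, fun b => b.z,
   fun b => Nat.mul b.x (Nat.sub b.x 1), fun b => Nat.mul b.y (Nat.sub b.y 1),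
   fun b => Nat.mul b.z (Nat.sub b.z 1),
   fun b => Nat.mul b.x b.y, fun b => Nat.mul b.x b.z, fun b => Nat.mul b.y b.z]

/-- Falling factorials of order three. -/
def fsNew : List (P4 → ℕ) :=
  [fun b => Nat.mul (Nat.mul b.x (Nat.sub b.x 1)) (Nat.sub b.x 2),
   fun b => Nat.mul (Nat.mul b.y (Nat.sub b.y 1)) (Nat.sub b.y 2),
   fun b => Nat.mul (Nat.mul b.z (Nat.sub b.z 1)) (Nat.sub b.z 2),
   fun b => Nat.mul (Nat.mul b.x (Nat.sub b.x 1)) b.y,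
   fun b => Nat.mul (Nat.mul b.x (Nat.sub b.x 1)) b.z,
   fun b => Nat.mul (Nat.mul b.y (Nat.sub b.y 1)) b.x,
   fun b => Nat.mul (Nat.mul b.y (Nat.sub b.y 1)) b.z,
   fun b => Nat.mul (Nat.mul b.z (Nat.sub b.z 1)) b.x,
   fun b => Nat.mul (Nat.mul b.z (Nat.sub b.z 1)) b.y,
   fun b => Nat.mul (Nat.mul b.x b.y) b.z]

/-- Falling factorials of order at most three. -/
def fs4 : List (P4 → ℕ) := fs3 ++ fsNew

/-- Weight of an exponent vector. -/
def wt (w b : P4) : ℕ :=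
  Nat.add (Nat.add (Nat.mul w.x b.x) (Nat.mul w.y b.y))
    (Nat.add (Nat.mul w.z b.z) (Nat.mul w.t b.t))

/-- Singleton lists of points with keys. -/
noncomputable def decorate (w : P4) (D : List P4) : List (List (ℕ × P4)) :=
  List.rec (motive := fun _ => List (List (ℕ × P4))) []
    (fun b _ ih => forceNat (Nat.succ (wt w b)) fun n => [(n, b)] :: ih) D

/-- Merge two sorted lists. -/
noncomputable def mergeL (l₁ : List (ℕ × P4)) : List (ℕ × P4) → List (ℕ × P4) :=
  List.rec (motive := fun _ => List (ℕ × P4) → List (ℕ × P4)) (fun l₂ => l₂)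
    (fun a l₁ ih l₂ => List.rec (motive := fun _ => List (ℕ × P4)) (a :: l₁)
      (fun b l₂ ih₂ => bif Nat.ble a.1 b.1 then a :: ih (b :: l₂) else b :: ih₂) l₂) l₁

/-- Merge neighbouring lists; `o` is a pending list. -/
noncomputable def mergePairs (L : List (List (ℕ × P4))) :
    Option (List (ℕ × P4)) → List (List (ℕ × P4)) :=
  List.rec (motive := fun _ => Option (List (ℕ × P4)) → List (List (ℕ × P4)))
    (fun o => Option.rec (motive := fun _ => List (List (ℕ × P4))) [] (fun a => [a]) o)
    (fun b _ ih o => Option.rec (motive := fun _ => List (List (ℕ × P4))) (ih (some b))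
      (fun a => mergeL a b :: ih none) o) L

/-- Repeated merging. -/
noncomputable def mergeRounds (n : ℕ) : List (List (ℕ × P4)) → List (List (ℕ × P4)) :=
  Nat.rec (motive := fun _ => List (List (ℕ × P4)) → List (List (ℕ × P4))) (fun l => l)
    (fun _ ih l => ih (mergePairs l none)) n

/-- Check strict sortedness, and forget the keys. -/
noncomputable def stripKeys (l : List (ℕ × P4)) : ℕ → Option (List P4) :=
  List.rec (motive := fun _ => ℕ → Option (List P4)) (fun _ => some [])
    (fun p _ ih n => Prod.rec (motive := fun _ => Option (List P4)) (fun k b =>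
      bif Nat.blt n k then
        Option.rec (motive := fun _ => Option (List P4)) none (fun l => some (b :: l)) (ih k)
      else none) p) l

/-- Sort by weight. -/
noncomputable def sortBy (w : P4) (D : List P4) : Option (List P4) :=
  match mergeRounds 11 (decorate w D) with
  | [l] => stripKeys l 0
  | _ => none

/-- Certificates. -/
inductive CTree where
  | leaf : CTree
  | node : P4 → CTree → P4 → CTree → CTree

/-- Run one branch of a certificate node. -/
noncomputable def runSide (fs : List (P4 → ℕ)) (n k : ℕ) (w : P4) (D : List P4) :
    Option (List P4) :=
  bif Nat.beq w.x w.y then none else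
    match sortBy w D with
    | none => none
    | some D' => chain fs n k D'

/-- Check a certificate. -/
noncomputable def checkTree : CTree → List ℕ → List P4 → Bool
  | .leaf, [], [] => true
  | .node wc c wq q, k :: ks, D =>
    (match runSide fs4 60 k wc D with
      | none => false
      | some D' => checkTree c ks D') &&
    (match runSide fs3 40 (Nat.mul 2 k) wq D with
      | none => false
      | some D' => checkTree q ks D')
  | _, _, _ => false

/-- Points on a line. -/
noncomputable def lineZ (x y s : ℕ) (n : ℕ) : List P4 → List P4 :=
  Nat.rec (motive := fun _ => List P4 → List P4) (fun acc => ⟨x, y, 0, s⟩ :: acc)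
    (fun z ih acc => forceNat (Nat.sub s (Nat.succ z)) fun t =>
      forceNat (Nat.succ z) fun z' => ⟨x, y, z', t⟩ :: ih acc) n

/-- Points of a plane. -/
noncomputable def planeY (x s : ℕ) (n : ℕ) : List P4 → List P4 :=
  Nat.rec (motive := fun _ => List P4 → List P4) (fun acc => lineZ x 0 s s acc)
    (fun y ih acc => forceNat (Nat.sub s (Nat.succ y)) fun t =>
      forceNat (Nat.succ y) fun y' => lineZ x y' t t (ih acc)) n

/-- All exponent vectors of degree `s` with first exponent at most `n`. -/
noncomputable def spaceX (s : ℕ) (n : ℕ) : List P4 :=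
  Nat.rec (motive := fun _ => List P4) (planeY 0 s s [])
    (fun x ih => forceNat (Nat.sub s (Nat.succ x)) fun t =>
      forceNat (Nat.succ x) fun x' => planeY x' t t ih) n

/-- All exponent vectors of degree 17. -/
noncomputable def fullD : List P4 := spaceX 17 17

/-- The certificate. -/
def certTree : CTree :=
  (.node ⟨49494, 27734, 9126, 40866⟩ (.node ⟨18367, 14419, 19896, 2264⟩ (.node ⟨5463, 3830, 4374, 1340⟩ (.node ⟨223, 1226, 961, 1258⟩ (.node ⟨491, 165, 442, 471⟩ (.node ⟨1, 73, 109, 103⟩ .leaf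
        ⟨30, 196, 145, 55⟩ .leaf)
       ⟨765, 88, 571, 456⟩ (.node ⟨48, 0, 113, 196⟩ .leaf
        ⟨197, 195, 165, 81⟩ .leaf))
      ⟨819, 636, 144, 1148⟩ (.node ⟨98, 100, 637, 407⟩ (.node ⟨27, 68, 51, 13⟩ .leaf
        ⟨82, 10, 171, 194⟩ .leaf)
       ⟨257, 727, 261, 757⟩ (.node ⟨63, 15, 160, 140⟩ .leaf
        ⟨97, 28, 68, 140⟩ .leaf)))
     ⟨5885, 4882, 3154, 4413⟩ (.node ⟨403, 1834, 1521, 1231⟩ (.node ⟨109, 460, 643, 238⟩ (.node ⟨197, 90, 139, 7⟩ .leaf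
        ⟨139, 51, 77, 60⟩ .leaf)
       ⟨468, 197, 569, 546⟩ (.node ⟨28, 143, 54, 177⟩ .leaf
        ⟨110, 183, 121, 161⟩ .leaf))
      ⟨203, 581, 929, 27⟩ (.node ⟨484, 163, 620, 692⟩ (.node ⟨130, 16, 125, 26⟩ .leaf
        ⟨91, 89, 28, 137⟩ .leaf)
       ⟨207, 82, 205, 245⟩ (.node ⟨122, 110, 132, 163⟩ .leaf
        ⟨39, 89, 191, 52⟩ .leaf))))
    ⟨16351, 8157, 1125, 3146⟩ (.node ⟨5670, 2172, 1001, 3004⟩ (.node ⟨270, 1965, 911, 1455⟩ (.node ⟨403, 531, 776, 154⟩ (.node ⟨82, 80, 18, 4⟩ .leaf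
        ⟨166, 99, 175, 116⟩ .leaf)
       ⟨580, 240, 438, 395⟩ (.node ⟨22, 130, 148, 36⟩ .leaf
        ⟨68, 165, 36, 135⟩ .leaf))
      ⟨1158, 800, 1723, 123⟩ (.node ⟨121, 294, 375, 365⟩ (.node ⟨79, 105, 11, 1⟩ .leaf
        ⟨11, 97, 187, 102⟩ .leaf)
       ⟨123, 414, 721, 394⟩ (.node ⟨52, 40, 133, 123⟩ .leaf
        ⟨64, 97, 152, 99⟩ .leaf)))
     ⟨1564, 2722, 2565, 2292⟩ (.node ⟨1973, 822, 146, 335⟩ (.node ⟨18, 169, 255, 695⟩ (.node ⟨77, 18, 118, 145⟩ .leaf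
        ⟨78, 134, 187, 142⟩ .leaf)
       ⟨135, 453, 632, 568⟩ (.node ⟨129, 189, 9, 161⟩ .leaf
        ⟨6, 34, 80, 124⟩ .leaf))
      ⟨536, 1206, 1058, 918⟩ (.node ⟨90, 300, 361, 586⟩ (.node ⟨38, 16, 76, 111⟩ .leaf
        ⟨140, 86, 170, 8⟩ .leaf)
       ⟨192, 410, 500, 708⟩ (.node ⟨109, 199, 133, 139⟩ .leaf
        ⟨170, 116, 82, 64⟩ .leaf)))))
   ⟨23291, 4838, 33197, 39258⟩ (.node ⟨14876, 506, 7905, 17460⟩ (.node ⟨5571, 4321, 1305, 3647⟩ (.node ⟨1080, 745, 1905, 1664⟩ (.node ⟨31, 367, 698, 317⟩ (.node ⟨153, 41, 26, 132⟩ .leaf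
        ⟨191, 44, 79, 181⟩ .leaf)
       ⟨518, 598, 560, 137⟩ (.node ⟨174, 15, 1, 65⟩ .leaf
        ⟨102, 168, 174, 41⟩ .leaf))
      ⟨1100, 1360, 564, 14⟩ (.node ⟨6, 623, 355, 218⟩ (.node ⟨187, 82, 65, 2⟩ .leaf
        ⟨189, 74, 25, 184⟩ .leaf)
       ⟨78, 524, 261, 88⟩ (.node ⟨155, 91, 152, 71⟩ .leaf
        ⟨118, 41, 20, 168⟩ .leaf)))
     ⟨5718, 3527, 539, 1886⟩ (.node ⟨74, 1126, 1828, 632⟩ (.node ⟨287, 654, 77, 270⟩ (.node ⟨79, 181, 23, 60⟩ .leaf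
        ⟨11, 44, 187, 149⟩ .leaf)
       ⟨615, 647, 23, 440⟩ (.node ⟨103, 139, 174, 190⟩ .leaf
        ⟨53, 135, 6, 147⟩ .leaf))
      ⟨1581, 1768, 1352, 1132⟩ (.node ⟨322, 523, 642, 590⟩ (.node ⟨82, 169, 150, 79⟩ .leaf
        ⟨198, 144, 92, 151⟩ .leaf)
       ⟨198, 561, 348, 39⟩ (.node ⟨54, 174, 103, 184⟩ .leaf
        ⟨142, 119, 43, 57⟩ .leaf))))
    ⟨10540, 14380, 11548, 2904⟩ (.node ⟨702, 1819, 5518, 3011⟩ (.node ⟨1877, 1618, 1018, 366⟩ (.node ⟨202, 616, 147, 777⟩ (.node ⟨18, 54, 102, 70⟩ .leaf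
        ⟨78, 26, 125, 162⟩ .leaf)
       ⟨63, 230, 247, 342⟩ (.node ⟨122, 125, 136, 36⟩ .leaf
        ⟨80, 177, 127, 65⟩ .leaf))
      ⟨1672, 1156, 120, 1010⟩ (.node ⟨69, 78, 515, 314⟩ (.node ⟨92, 176, 126, 93⟩ .leaf
        ⟨100, 61, 177, 116⟩ .leaf)
       ⟨679, 432, 193, 265⟩ (.node ⟨16, 134, 15, 189⟩ .leaf
        ⟨119, 114, 162, 125⟩ .leaf)))
     ⟨2920, 4120, 558, 2283⟩ (.node ⟨1281, 1659, 1566, 499⟩ (.node ⟨339, 690, 194, 584⟩ (.node ⟨75, 41, 62, 186⟩ .leaf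
        ⟨156, 42, 96, 138⟩ .leaf)
       ⟨303, 483, 174, 305⟩ (.node ⟨180, 80, 50, 190⟩ .leaf
        ⟨19, 189, 49, 192⟩ .leaf))
      ⟨1122, 283, 703, 1680⟩ (.node ⟨23, 139, 150, 65⟩ (.node ⟨173, 9, 46, 197⟩ .leaf
        ⟨159, 81, 78, 5⟩ .leaf)
       ⟨110, 160, 799, 587⟩ (.node ⟨33, 41, 168, 125⟩ .leaf
        ⟨16, 32, 194, 111⟩ .leaf))))))

/-! ### Soundness of the elimination -/

theorem forceNat_eq {α : Type} (n : ℕ) (k : ℕ → α) : forceNat n k = k n := by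
  cases n <;> rfl

/-- Packing of integer values. -/
def packZ (q : P4 → ℤ) : ℕ → List P4 → ℤ
  | 0, _ => 0
  | _ + 1, [] => 0
  | n + 1, β :: P => q β + (base : ℤ) * packZ q n P

/-- The meaning of a row: it represents a function `q` of the span `Q` which vanishes on `pre`. -/
def RowOK (Q : Submodule ℚ (P4 → ℚ)) (pre : List P4) (n : ℕ) (P : List P4) (r : Row) : Prop :=
  r.1 < base ^ n ∧ r.2 ≤ halfBase ∧
    ∃ q : P4 → ℤ, (fun β => (q β : ℚ)) ∈ Q ∧ (∀ β ∈ pre, q β = 0) ∧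
      (∀ β ∈ P.take n, |q β| ≤ (r.2 : ℤ)) ∧ (r.1 : ℤ) ≡ packZ q n P [ZMOD (base : ℤ) ^ n]

theorem base_eq : base = 2 * halfBase + 1 := by rfl

theorem base_pos : 0 < base := by rw [base_eq]; omega

theorem digit_congr {R n : ℕ} {x y : ℤ}
    (h : (R : ℤ) ≡ x + (base : ℤ) * y [ZMOD (base : ℤ) ^ (n + 1)]) :
    ((R % base : ℕ) : ℤ) ≡ x [ZMOD (base : ℤ)] := by
  have h1 : (R : ℤ) ≡ x + (base : ℤ) * y [ZMOD (base : ℤ)] :=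
    h.of_dvd (dvd_pow_self _ (Nat.succ_ne_zero n))
  have h2 : x + (base : ℤ) * y ≡ x [ZMOD (base : ℤ)] := by
    simp [Int.ModEq]
  have h3 : ((R % base : ℕ) : ℤ) ≡ R [ZMOD (base : ℤ)] := by
    simp [Int.ModEq]
  exact h3.trans (h1.trans h2)

theorem eq_of_congr_base {x y : ℤ} (h : x ≡ y [ZMOD (base : ℤ)])
    (hx : |x| ≤ halfBase) (hy : |y| ≤ halfBase) : x = y := by
  have hd := h.symm.dvd
  rw [abs_le] at hx hy
  have hb : (base : ℤ) = 2 * halfBase + 1 := by rw [base_eq]; push_cast; ring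
  have : x - y = 0 := by
    apply Int.eq_zero_of_abs_lt_dvd hd
    rw [abs_lt, hb]
    constructor <;> linarith [hx.1, hx.2, hy.1, hy.2]
  linarith

theorem shift_congr {R n : ℕ} {y : ℤ}
    (h : (R : ℤ) ≡ (base : ℤ) * y [ZMOD (base : ℤ) ^ (n + 1)]) :
    ((R / base : ℕ) : ℤ) ≡ y [ZMOD (base : ℤ) ^ n] := by
  have hb : (base : ℤ) ≠ 0 := by exact_mod_cast base_pos.ne'
  obtain ⟨t, ht⟩ := h.symm.dvd
  have hR : (R : ℤ) = (base : ℤ) * (y + (base : ℤ) ^ n * t) := by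
    rw [pow_succ] at ht; linear_combination ht
  have : ((R / base : ℕ) : ℤ) = y + (base : ℤ) ^ n * t := by
    push_cast
    rw [hR, Int.mul_ediv_cancel_left _ hb]
  rw [this]
  simp [Int.ModEq]

theorem RowOK.shift {Q : Submodule ℚ (P4 → ℚ)} {pre : List P4} {n : ℕ} {β : P4} {P : List P4}
    {R c : ℕ} (hc : c ≤ halfBase) (hR : R < base ^ (n + 1)) {q : P4 → ℤ}
    (hq : (fun β => (q β : ℚ)) ∈ Q) (hpre : ∀ β ∈ pre, q β = 0) (h0 : q β = 0)
    (hbd : ∀ β ∈ P.take n, |q β| ≤ (c : ℤ))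
    (h : (R : ℤ) ≡ packZ q (n + 1) (β :: P) [ZMOD (base : ℤ) ^ (n + 1)]) :
    RowOK Q (β :: pre) n P (R / base, c) := by
  refine ⟨?_, hc, q, hq, ?_, hbd, ?_⟩
  · apply Nat.div_lt_of_lt_mul
    rwa [pow_succ, mul_comm] at hR
  · intro γ hγ
    rcases List.mem_cons.1 hγ with rfl | hγ
    · exact h0
    · exact hpre γ hγ
  · apply shift_congr
    simpa [packZ, h0] using h

theorem abs_digit {d : ℕ} (hd : d ≤ halfBase) : |(d : ℤ)| ≤ halfBase := by
  rw [abs_of_nonneg (by positivity)]; exact_mod_cast hd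

/-- A zero digit can be dropped. -/
theorem RowOK.zero {Q : Submodule ℚ (P4 → ℚ)} {pre : List P4} {n : ℕ} {β : P4} {P : List P4}
    {R c : ℕ} (h : RowOK Q pre (n + 1) (β :: P) (R, c)) (hz : R % base = 0) :
    RowOK Q (β :: pre) n P (R / base, c) := by
  obtain ⟨hR, hc, q, hq, hpre, hbd, hcong⟩ := h
  have hb : |q β| ≤ (c : ℤ) := hbd β (by simp)
  have hc' : (c : ℤ) ≤ halfBase := by exact_mod_cast hc
  have h1 : ((0 : ℕ) : ℤ) ≡ q β [ZMOD (base : ℤ)] := by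
    rw [← hz]; exact digit_congr hcong
  have h0 : q β = 0 := by
    have := eq_of_congr_base h1 (by simp) (hb.trans hc')
    simpa using this.symm
  exact RowOK.shift hc hR hq hpre h0 (fun γ hγ => hbd γ (by simp [hγ])) hcong

/-- The sign attached to a flag. -/
def sg (b : Bool) : ℤ := if b then -1 else 1

/-- Recover the exact value at the first point from the last digit. -/
theorem RowOK.value {Q : Submodule ℚ (P4 → ℚ)} {pre : List P4} {n : ℕ} {β : P4} {P : List P4}
    {R c : ℕ} (h : RowOK Q pre (n + 1) (β :: P) (R, c)) {d : ℕ} {neg : Bool}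
    (hd : (neg = false ∧ d = R % base ∧ d ≤ halfBase) ∨
      (neg = true ∧ d = base - R % base ∧ ¬ R % base ≤ halfBase)) :
    ∃ q : P4 → ℤ, (fun β => (q β : ℚ)) ∈ Q ∧ (∀ β ∈ pre, q β = 0) ∧
      (∀ β ∈ P.take n, |q β| ≤ (c : ℤ)) ∧ (R : ℤ) ≡ packZ q (n + 1) (β :: P)
        [ZMOD (base : ℤ) ^ (n + 1)] ∧ q β = sg neg * d := by
  obtain ⟨hR, hc, q, hq, hpre, hbd, hcong⟩ := h
  refine ⟨q, hq, hpre, fun γ hγ => hbd γ (by simp [hγ]), hcong, ?_⟩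
  have hb : |q β| ≤ (c : ℤ) := hbd β (by simp)
  have hc' : (c : ℤ) ≤ halfBase := by exact_mod_cast hc
  have h1 := digit_congr hcong
  have hlt : R % base < base := Nat.mod_lt _ base_pos
  have hbe := base_eq
  rcases hd with ⟨rfl, rfl, hd⟩ | ⟨rfl, rfl, hd⟩
  · have := eq_of_congr_base h1 (abs_digit hd) (hb.trans hc')
    simp [sg, ← this]
  · have h2 : (((R % base : ℕ) : ℤ) - base) ≡ q β [ZMOD (base : ℤ)] := by
      refine Int.ModEq.trans ?_ h1
      simp [Int.ModEq]
    have := eq_of_congr_base h2 (by rw [abs_le]; constructor <;> omega) (hb.trans hc')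
    rw [← this]
    simp only [sg, if_true]
    rw [Nat.cast_sub hlt.le]
    ring

theorem packZ_comb (A B : ℤ) (q r : P4 → ℤ) : ∀ (n : ℕ) (P : List P4),
    packZ (fun β => A * q β + B * r β) n P = A * packZ q n P + B * packZ r n P
  | 0, _ => by simp [packZ]
  | _ + 1, [] => by simp [packZ]
  | n + 1, β :: P => by simp only [packZ, packZ_comb A B q r n P]; ring

theorem RowOK.comb {Q : Submodule ℚ (P4 → ℚ)} {pre : List P4} {n : ℕ} {β : P4} {P : List P4}
    {e d : ℕ} {sgn s1 s2 : Bool} {rR rc sR sc : ℕ} {r' : Row} {qr qs : P4 → ℤ}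
    (hrR : rR < base ^ (n + 1))
    (hqr : (fun β => (qr β : ℚ)) ∈ Q) (hqs : (fun β => (qs β : ℚ)) ∈ Q)
    (hrpre : ∀ β ∈ pre, qr β = 0) (hspre : ∀ β ∈ pre, qs β = 0)
    (hrb : ∀ β ∈ P.take n, |qr β| ≤ (rc : ℤ)) (hsb : ∀ β ∈ P.take n, |qs β| ≤ (sc : ℤ))
    (hrc : (rR : ℤ) ≡ packZ qr (n + 1) (β :: P) [ZMOD (base : ℤ) ^ (n + 1)])
    (hsc : (sR : ℤ) ≡ packZ qs (n + 1) (β :: P) [ZMOD (base : ℤ) ^ (n + 1)])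
    (hr : qr β = sg s1 * e) (hs : qs β = sg s2 * d) (hsgn : sg s2 + sg (sgn) * sg s1 = 0)
    (h : combRow (base ^ (n + 1)) e d sgn rR rc sR sc = some r') :
    RowOK Q (β :: pre) n P r' := by
  unfold combRow at h
  simp only [forceNat_eq] at h
  set g := Nat.gcd e d with hg
  set A := Nat.div e g with hA
  set B := Nat.div d g with hB
  have hAe : A * g = e := Nat.div_mul_cancel (Nat.gcd_dvd_left e d)
  have hBd : B * g = d := Nat.div_mul_cancel (Nat.gcd_dvd_right e d)
  set c := Nat.add (Nat.mul A sc) (Nat.mul B rc) with hcdef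
  have hc2 : c = A * sc + B * rc := rfl
  cases hble : Nat.ble c halfBase with
  | false => rw [hble] at h; simp at h
  | true =>
    rw [hble] at h
    simp only [cond_true, Option.some.injEq] at h
    subst h
    have hc : c ≤ halfBase := Nat.le_of_ble_eq_true hble
    refine RowOK.shift (q := fun β => (A : ℤ) * qs β + (sg sgn * B) * qr β) hc
      (Nat.mod_lt _ (pow_pos base_pos _)) ?_ ?_ ?_ ?_ ?_
    · have := Q.add_mem (Q.smul_mem (A : ℚ) hqs) (Q.smul_mem ((sg sgn * B : ℤ) : ℚ) hqr)
      convert this using 1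
      ext β
      simp
    · intro γ hγ
      simp [hrpre γ hγ, hspre γ hγ]
    · simp only [hr, hs]
      rw [← hAe, ← hBd]
      push_cast
      linear_combination (A : ℤ) * B * g * hsgn
    · intro γ hγ
      have h1 : |sg sgn| = 1 := by cases sgn <;> simp [sg]
      calc |(A : ℤ) * qs γ + (sg sgn * B) * qr γ|
          ≤ |(A : ℤ) * qs γ| + |(sg sgn * B) * qr γ| := abs_add_le _ _
        _ = A * |qs γ| + B * |qr γ| := by
          rw [abs_mul, abs_mul, abs_mul, h1]; simp
        _ ≤ A * sc + B * rc := by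
          gcongr
          · exact hsb γ hγ
          · exact hrb γ hγ
        _ = (c : ℤ) := by rw [hc2]; push_cast; ring
    · rw [packZ_comb]
      have key : ((Nat.mod (Nat.add (Nat.mul A sR)
          (Nat.mul B (bif sgn then Nat.sub (base ^ (n + 1)) rR else rR))) (base ^ (n + 1)) : ℕ) : ℤ)
          ≡ (A : ℤ) * sR + (sg sgn * B) * rR [ZMOD (base : ℤ) ^ (n + 1)] := by
        change (((A * sR + B * (bif sgn then base ^ (n + 1) - rR else rR)) %
          (base ^ (n + 1)) : ℕ) : ℤ) ≡ _ [ZMOD _]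
        push_cast
        refine (Int.mod_modEq _ _).trans ?_
        cases sgn with
        | false => simp [sg]
        | true =>
          simp only [cond_true, sg, if_true]
          rw [Nat.cast_sub hrR.le]
          push_cast
          apply Int.ModEq.symm
          rw [Int.modEq_iff_dvd]
          exact ⟨B, by ring⟩
      exact key.trans ((hsc.mul_left _).add (hrc.mul_left _))

theorem reduceRow_spec {Q : Submodule ℚ (P4 → ℚ)} {pre : List P4} {n : ℕ} {β : P4} {P : List P4}
    {e : ℕ} {neg : Bool} {rR rc sR sc : ℕ} {r' : Row} {qr : P4 → ℤ}
    (hrR : rR < base ^ (n + 1))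
    (hqr : (fun β => (qr β : ℚ)) ∈ Q)
    (hrpre : ∀ β ∈ pre, qr β = 0)
    (hrb : ∀ β ∈ P.take n, |qr β| ≤ (rc : ℤ))
    (hrc : (rR : ℤ) ≡ packZ qr (n + 1) (β :: P) [ZMOD (base : ℤ) ^ (n + 1)])
    (hr : qr β = sg neg * e)
    (hs : RowOK Q pre (n + 1) (β :: P) (sR, sc))
    (h : reduceRow (base ^ (n + 1)) e neg rR rc sR sc = some r') :
    RowOK Q (β :: pre) n P r' := by
  unfold reduceRow at h
  simp only [forceNat_eq] at h
  change (bif Nat.beq (sR % base) 0 then _ else bif Nat.ble (sR % base) halfBase then _ else _)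
    = _ at h
  cases hb : Nat.beq (sR % base) 0 with
  | true =>
    rw [hb] at h
    simp only [cond_true, Option.some.injEq] at h
    subst h
    exact hs.zero (Nat.eq_of_beq_eq_true hb)
  | false =>
    rw [hb] at h
    cases hble : Nat.ble (sR % base) halfBase with
    | true =>
      rw [hble] at h
      simp only [cond_true, cond_false] at h
      obtain ⟨qs, h1, h2, h3, h4, h5⟩ := hs.value (d := sR % base) (neg := false)
        (Or.inl ⟨rfl, rfl, Nat.le_of_ble_eq_true hble⟩)
      exact RowOK.comb hrR hqr h1 hrpre h2 hrb h3 hrc h4 hr h5 (by cases neg <;> simp [sg]) h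
    | false =>
      rw [hble] at h
      simp only [cond_false] at h
      obtain ⟨qs, h1, h2, h3, h4, h5⟩ := hs.value (d := base - sR % base) (neg := true)
        (Or.inr ⟨rfl, rfl, fun hle => by rw [Nat.ble_eq_true_of_le hle] at hble; simp at hble⟩)
      exact RowOK.comb hrR hqr h1 hrpre h2 hrb h3 hrc h4 hr h5 (by cases neg <;> simp [sg]) h

theorem reduceAll_spec {Q : Submodule ℚ (P4 → ℚ)} {pre : List P4} {n : ℕ} {β : P4} {P : List P4}
    {e : ℕ} {neg : Bool} {rR rc : ℕ} {qr : P4 → ℤ}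
    (hrR : rR < base ^ (n + 1))
    (hqr : (fun β => (qr β : ℚ)) ∈ Q)
    (hrpre : ∀ β ∈ pre, qr β = 0)
    (hrb : ∀ β ∈ P.take n, |qr β| ≤ (rc : ℤ))
    (hrc : (rR : ℤ) ≡ packZ qr (n + 1) (β :: P) [ZMOD (base : ℤ) ^ (n + 1)])
    (hr : qr β = sg neg * e) (rs : List Row) :
    ∀ out : List Row, (∀ s ∈ rs, RowOK Q pre (n + 1) (β :: P) s) →
      reduceAll (base ^ (n + 1)) e neg rR rc rs = some out →
      ∀ s ∈ out, RowOK Q (β :: pre) n P s := by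
  induction rs with
  | nil =>
    intro out _ h
    obtain rfl : [] = out := by simpa [reduceAll] using h
    simp
  | cons s rs ih =>
    intro out hs h
    obtain ⟨sR, sc⟩ := s
    have hs0 := hs _ List.mem_cons_self
    have h' : (Option.rec (motive := fun _ => Option (List Row)) none
      (fun s' => Option.rec (motive := fun _ => Option (List Row)) none
        (fun l => some (s' :: l)) (reduceAll (base ^ (n + 1)) e neg rR rc rs))
        (reduceRow (base ^ (n + 1)) e neg rR rc sR sc)) = some out := h
    cases h1 : reduceRow (base ^ (n + 1)) e neg rR rc sR sc with
    | none => rw [h1] at h'; simp at h'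
    | some s' =>
      rw [h1] at h'
      cases h2 : reduceAll (base ^ (n + 1)) e neg rR rc rs with
      | none => rw [h2] at h'; simp at h'
      | some l =>
        rw [h2] at h'
        obtain rfl : s' :: l = out := by simpa using h'
        intro t ht
        rcases List.mem_cons.1 ht with rfl | ht
        · exact reduceRow_spec hrR hqr hrpre hrb hrc hr hs0 h1
        · exact ih l (fun s hs' => hs s (List.mem_cons_of_mem _ hs')) h2 t ht

theorem scanRows_spec {Q : Submodule ℚ (P4 → ℚ)} {pre : List P4} {n : ℕ} {β : P4} {P : List P4}
    (rs : List Row) :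
    ∀ (f : Bool) (out : List Row), (∀ s ∈ rs, RowOK Q pre (n + 1) (β :: P) s) →
      scanRows (base ^ (n + 1)) rs = some (f, out) →
      (∀ s ∈ out, RowOK Q (β :: pre) n P s) ∧
      (f = true → ∃ q : P4 → ℤ, (fun β => (q β : ℚ)) ∈ Q ∧ (∀ β ∈ pre, q β = 0) ∧ q β ≠ 0) := by
  induction rs with
  | nil =>
    intro f out _ h
    obtain ⟨rfl, rfl⟩ : false = f ∧ [] = out := by simpa [scanRows] using h
    simp
  | cons r rs ih =>
    intro f out hs h
    obtain ⟨rR, rc⟩ := r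
    have hr0 := hs _ List.mem_cons_self
    have hs' : ∀ s ∈ rs, RowOK Q pre (n + 1) (β :: P) s :=
      fun s hs' => hs s (List.mem_cons_of_mem _ hs')
    have h' : (forceNat (Nat.mod rR base) fun d =>
      bif Nat.beq d 0 then
        forceNat (Nat.div rR base) fun R =>
          Option.rec (motive := fun _ => Option (Bool × List Row)) none
            (fun p => Prod.rec (motive := fun _ => Option (Bool × List Row))
              (fun f l => some (f, (R, rc) :: l)) p) (scanRows (base ^ (n + 1)) rs)
      else
        Option.rec (motive := fun _ => Option (Bool × List Row)) none
          (fun l => some (true, l))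
          (bif Nat.ble d halfBase then reduceAll (base ^ (n + 1)) d false rR rc rs
            else forceNat (Nat.sub base d) fun d' =>
              reduceAll (base ^ (n + 1)) d' true rR rc rs)) = some (f, out) := h
    simp only [forceNat_eq] at h'
    change (bif Nat.beq (rR % base) 0 then _ else
      Option.rec (motive := fun _ => Option (Bool × List Row)) none (fun l => some (true, l))
      (bif Nat.ble (rR % base) halfBase then _ else _)) = _ at h'
    cases hb : Nat.beq (rR % base) 0 with
    | true =>
      rw [hb] at h'
      simp only [cond_true] at h'
      cases h1 : scanRows (base ^ (n + 1)) rs with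
      | none => rw [h1] at h'; simp at h'
      | some p =>
        obtain ⟨f', l⟩ := p
        rw [h1] at h'
        obtain ⟨rfl, rfl⟩ : f' = f ∧ (rR / base, rc) :: l = out := by
          have h'' : some (f', (rR / base, rc) :: l) = some (f, out) := h'
          simpa using h''
        obtain ⟨h2, h3⟩ := ih f' l hs' h1
        refine ⟨?_, h3⟩
        intro t ht
        rcases List.mem_cons.1 ht with rfl | ht
        · exact hr0.zero (Nat.eq_of_beq_eq_true hb)
        · exact h2 t ht
    | false =>
      rw [hb] at h'
      simp only [cond_false] at h'
      have hne : rR % base ≠ 0 := by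
        intro h0; rw [h0] at hb; simp at hb
      have hlt : rR % base < base := Nat.mod_lt _ base_pos
      have main : ∀ (d : ℕ) (neg : Bool) (o : Option (List Row)), d ≠ 0 →
          ((neg = false ∧ d = rR % base ∧ d ≤ halfBase) ∨
            (neg = true ∧ d = base - rR % base ∧ ¬ rR % base ≤ halfBase)) →
          o = reduceAll (base ^ (n + 1)) d neg rR rc rs →
          (Option.rec (motive := fun _ => Option (Bool × List Row)) none
            (fun l => some (true, l)) o) = some (f, out) →
          (∀ s ∈ out, RowOK Q (β :: pre) n P s) ∧
      (f = true → ∃ q : P4 → ℤ, (fun β => (q β : ℚ)) ∈ Q ∧ (∀ β ∈ pre, q β = 0) ∧ q β ≠ 0) := by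
        intro d neg o hd0 hd ho h'
        obtain ⟨q, h1, h2, h3, h4, h5⟩ := hr0.value hd
        cases o with
        | none => simp at h'
        | some l =>
          obtain ⟨rfl, rfl⟩ : true = f ∧ l = out := by simpa using h'
          refine ⟨reduceAll_spec hr0.1 h1 h2 h3 h4 h5 rs l hs' ho.symm, fun _ => ⟨q, h1, h2, ?_⟩⟩
          rw [h5]
          have : (d : ℤ) ≠ 0 := by exact_mod_cast hd0
          cases neg <;> simpa [sg] using this
      cases hble : Nat.ble (rR % base) halfBase with
      | true =>
        rw [hble] at h'
        simp only [cond_true] at h'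
        exact main _ _ _ hne (Or.inl ⟨rfl, rfl, Nat.le_of_ble_eq_true hble⟩) rfl h'
      | false =>
        rw [hble] at h'
        simp only [cond_false] at h'
        exact main (base - rR % base) true _ (by omega) (Or.inr ⟨rfl, rfl, fun hle => by
          rw [Nat.ble_eq_true_of_le hle] at hble; simp at hble⟩) rfl h'

/-- `out` arises from `P` by deleting points that are detected by functions of `Q`. -/
def Removes (Q : Submodule ℚ (P4 → ℚ)) (W : P4 → ℕ) (P out : List P4) : Prop :=
  out.Sublist P ∧ ∀ s ∈ P, s ∉ out → ∃ q ∈ Q, q s ≠ 0 ∧ ∀ β ∈ P, q β ≠ 0 → β ≠ s → W s < W β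

theorem natPow_eq (b n : ℕ) : Nat.pow b (Nat.succ n) = b ^ (n + 1) := rfl

theorem elimStep_nil (scan : ℕ → List Row → Option (Bool × List Row)) (n : ℕ) (P : List P4) : elimStep scan n P [] = some P := by
  cases n <;> rfl

theorem elimStep_zero_cons (scan : ℕ → List Row → Option (Bool × List Row)) (P : List P4) (r : Row) (rs : List Row) :
    elimStep scan 0 P (r :: rs) = none := rfl

theorem elimStep_succ_nil (scan : ℕ → List Row → Option (Bool × List Row)) (n : ℕ) (r : Row) (rs : List Row) :
    elimStep scan (n + 1) [] (r :: rs) = none := rfl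

/-- What to do after scanning one column. -/
noncomputable def elimNext (scan : ℕ → List Row → Option (Bool × List Row)) (n : ℕ) (β : P4) (P : List P4) (o : Option (Bool × List Row)) :
    Option (List P4) :=
  Option.rec (motive := fun _ => Option (List P4)) none
    (fun p => Prod.rec (motive := fun _ => Option (List P4)) (fun f rows' =>
      Bool.rec (motive := fun _ => Option (List P4))
        (Option.rec (motive := fun _ => Option (List P4)) none (fun l => some (β :: l))
          (elimStep scan n P rows'))
        (elimStep scan n P rows') f) p) o

theorem elimStep_succ_cons (scan : ℕ → List Row → Option (Bool × List Row)) (n : ℕ) (β : P4) (P : List P4) (r : Row) (rs : List Row) :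
    elimStep scan (n + 1) (β :: P) (r :: rs) =
      elimNext scan n β P (scan n (r :: rs)) := rfl

theorem elimNext_some (scan : ℕ → List Row → Option (Bool × List Row)) (n : ℕ) (β : P4) (P : List P4) (f : Bool) (rows : List Row) :
    elimNext scan n β P (some (f, rows)) = if f then elimStep scan n P rows else
      (elimStep scan n P rows).map (fun l => β :: l) := by
  cases f
  · change Option.rec (motive := fun _ => Option (List P4)) none (fun l => some (β :: l))
          (elimStep scan n P rows) = _
    cases elimStep scan n P rows <;> rfl
  · rfl

theorem elimStep_spec {Q : Submodule ℚ (P4 → ℚ)} {W : P4 → ℕ} (n : ℕ) :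
    ∀ (pre P : List P4) (rows : List Row) (out : List P4),
      P.Pairwise (fun a b => W a < W b) → (∀ s ∈ rows, RowOK Q pre n P s) →
      elimStep scanPow n P rows = some out →
      out.Sublist P ∧ ∀ s ∈ P, s ∉ out → ∃ q ∈ Q, q s ≠ 0 ∧ (∀ β ∈ pre, q β = 0) ∧
        ∀ β ∈ P, q β ≠ 0 → β ≠ s → W s < W β := by
  induction n with
  | zero =>
    intro pre P rows out _ _ h
    cases rows with
    | nil =>
      obtain rfl : P = out := by simpa [elimStep_nil] using h
      exact ⟨List.Sublist.refl _, fun s hs hs' => absurd hs hs'⟩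
    | cons _ _ => simp [elimStep_zero_cons] at h
  | succ n ih =>
    intro pre P rows out hP hrows h
    cases rows with
    | nil =>
      obtain rfl : P = out := by simpa [elimStep_nil] using h
      exact ⟨List.Sublist.refl _, fun s hs hs' => absurd hs hs'⟩
    | cons r rs =>
      cases P with
      | nil => simp [elimStep_succ_nil] at h
      | cons β P =>
        rw [elimStep_succ_cons, scanPow, forceNat_eq, natPow_eq] at h
        rw [List.pairwise_cons] at hP
        obtain ⟨hβ, hP⟩ := hP
        cases hsc : scanRows (base ^ (n + 1)) (r :: rs) with
        | none => rw [hsc] at h; simp [elimNext] at h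
        | some p =>
          obtain ⟨f, rows'⟩ := p
          rw [hsc, elimNext_some] at h
          obtain ⟨hrows', hf⟩ := scanRows_spec _ f rows' hrows hsc
          -- points after `β`
          have tail : ∀ l, elimStep scanPow n P rows' = some l → l.Sublist P ∧ ∀ s ∈ P, s ∉ l →
              ∃ q ∈ Q, q s ≠ 0 ∧ (∀ γ ∈ pre, q γ = 0) ∧
                ∀ γ ∈ β :: P, q γ ≠ 0 → γ ≠ s → W s < W γ := by
            intro l hl
            obtain ⟨h1, h2⟩ := ih (β :: pre) P rows' l hP hrows' hl
            refine ⟨h1, fun s hs hsl => ?_⟩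
            obtain ⟨q, hq, hqs, hpre, hlt⟩ := h2 s hs hsl
            refine ⟨q, hq, hqs, fun γ hγ => hpre γ (List.mem_cons_of_mem _ hγ), ?_⟩
            intro γ hγ hqγ hne
            rcases List.mem_cons.1 hγ with rfl | hγ
            · exact absurd (hpre γ List.mem_cons_self) hqγ
            · exact hlt γ hγ hqγ hne
          cases f with
          | false =>
            cases hl : elimStep scanPow n P rows' with
            | none => simp [hl] at h
            | some l =>
              obtain rfl : β :: l = out := by simpa [hl] using h
              obtain ⟨h1, h2⟩ := tail l hl
              refine ⟨h1.cons_cons β, fun s hs hsl => ?_⟩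
              rw [List.mem_cons, not_or] at hsl
              exact h2 s ((List.mem_cons.1 hs).resolve_left hsl.1) hsl.2
          | true =>
            obtain ⟨h1, h2⟩ := tail out (by simpa using h)
            refine ⟨h1.cons β, fun s hs hsl => ?_⟩
            rcases List.mem_cons.1 hs with rfl | hs
            · obtain ⟨q, hq, hpre, hqs⟩ := hf rfl
              refine ⟨_, hq, by exact_mod_cast hqs, fun γ hγ => by simp [hpre γ hγ], ?_⟩
              intro γ hγ _ hne
              exact hβ γ ((List.mem_cons.1 hγ).resolve_left hne)
            · exact h2 s hs hsl

theorem packNat_cons (f : P4 → ℕ) (n : ℕ) (β : P4) (P : List P4) :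
    packNat f (n + 1) (β :: P) = f β + base * packNat f n P := rfl

theorem packNat_spec (f : P4 → ℕ) : ∀ (n : ℕ) (P : List P4), (∀ β ∈ P, f β < base) →
    packNat f n P < base ^ n ∧ (packNat f n P : ℤ) = packZ (fun β => (f β : ℤ)) n P
  | 0, P, _ => by simp [packNat, packZ]
  | n + 1, [], _ => ⟨pow_pos base_pos _, rfl⟩
  | n + 1, β :: P, h => by
    obtain ⟨h1, h2⟩ := packNat_spec f n P fun γ hγ => h γ (List.mem_cons_of_mem _ hγ)
    have hβ := h β List.mem_cons_self
    rw [packNat_cons]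
    refine ⟨?_, ?_⟩
    · rw [pow_succ]
      calc f β + base * packNat f n P < base + base * packNat f n P := by omega
        _ = (packNat f n P + 1) * base := by ring
        _ ≤ base ^ n * base := Nat.mul_le_mul_right _ h1
    · push_cast
      rw [h2]; rfl

/-- The family `fs` consists of bounded functions of `Q`. -/
def FamOK (Q : Submodule ℚ (P4 → ℚ)) (P : List P4) (fs : List (P4 → ℕ)) : Prop :=
  ∀ f ∈ fs, (fun β => (f β : ℚ)) ∈ Q ∧ ∀ β ∈ P, f β ≤ 5000

theorem initRows_spec {Q : Submodule ℚ (P4 → ℚ)} {P : List P4} (n : ℕ) (fs : List (P4 → ℕ)) :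
    FamOK Q P fs → ∀ r ∈ initRows n P fs, RowOK Q [] n P r := by
  induction fs with
  | nil => intro _ r hr; simp [initRows] at hr
  | cons f fs ih =>
    intro h r hr
    have hr' : r ∈ (forceNat (packNat f n P) fun v => (v, 5000) :: initRows n P fs) := hr
    rw [forceNat_eq] at hr'
    rcases List.mem_cons.1 hr' with rfl | hr'
    · obtain ⟨h1, h2⟩ := h f List.mem_cons_self
      have hb : 5000 ≤ halfBase := by norm_num [halfBase]
      have hb' := base_eq
      obtain ⟨h3, h4⟩ := packNat_spec f n P fun β hβ => by have := h2 β hβ; omega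
      refine ⟨h3, hb, fun β => (f β : ℤ), by simpa using h1, by simp, ?_, ?_⟩
      · intro β hβ
        have := h2 β (List.mem_of_mem_take hβ)
        rw [abs_of_nonneg (by positivity)]
        change (f β : ℤ) ≤ ((5000 : ℕ) : ℤ)
        exact_mod_cast this
      · simp only [h4]; rfl
    · exact ih (fun f hf => h f (List.mem_cons_of_mem _ hf)) r hr'

theorem step_spec {Q : Submodule ℚ (P4 → ℚ)} {W : P4 → ℕ} {fs : List (P4 → ℕ)} {n : ℕ}
    {P out : List P4} (hfs : FamOK Q P fs) (hP : P.Pairwise (fun a b => W a < W b))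
    (h : elimStep scanPow n P (initRows n P fs) = some out) : Removes Q W P out := by
  obtain ⟨h1, h2⟩ := elimStep_spec n [] P _ out hP (initRows_spec n fs hfs) h
  refine ⟨h1, fun s hs hs' => ?_⟩
  obtain ⟨q, hq, hqs, _, h3⟩ := h2 s hs hs'
  exact ⟨q, hq, hqs, h3⟩

/-- Induction principle for `chain`. -/
theorem chain_spec {Q : Submodule ℚ (P4 → ℚ)} {W : P4 → ℕ} {fs : List (P4 → ℕ)} {n : ℕ}
    (G : ℕ → List P4 → Prop)
    (hG : ∀ k P P', FamOK Q P fs → Removes Q W P P' → G k P' → G (k + 1) P) (k : ℕ) :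
    ∀ (P out : List P4), FamOK Q P fs → P.Pairwise (fun a b => W a < W b) →
      chain fs n k P = some out → G 0 out → G k P := by
  induction k with
  | zero =>
    intro P out _ _ h h0
    obtain rfl : P = out := by simpa [chain] using h
    exact h0
  | succ k ih =>
    intro P out hfs hP h h0
    have h' : Option.rec (motive := fun _ => Option (List P4)) none
      (fun P' => chain fs n k P') (elimStep scanPow n P (initRows n P fs)) = some out := h
    cases hs : elimStep scanPow n P (initRows n P fs) with
    | none => rw [hs] at h'; simp at h'
    | some P' =>
      rw [hs] at h'
      have hr := step_spec hfs hP hs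
      refine hG k P P' hfs hr (ih P' out ?_ (hP.sublist hr.1) h' h0)
      exact fun f hf => ⟨(hfs f hf).1, fun β hβ => (hfs f hf).2 β (hr.1.subset hβ)⟩

/-! ### Soundness of the sorting routine -/

theorem decorate_spec (w : P4) (D : List P4) :
    ((decorate w D).flatten.map Prod.snd) = D ∧
      ∀ p ∈ (decorate w D).flatten, p.1 = wt w p.2 + 1 := by
  induction D with
  | nil => simp [decorate]
  | cons b D ih =>
    have h : decorate w (b :: D) = [(wt w b + 1, b)] :: decorate w D := by
      change (forceNat (Nat.succ (wt w b)) fun n => [(n, b)] :: decorate w D) = _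
      rw [forceNat_eq]
    rw [h]
    refine ⟨by simp [ih.1], ?_⟩
    intro p hp
    simp only [List.flatten_cons, List.cons_append, List.nil_append, List.mem_cons] at hp
    rcases hp with rfl | hp
    · rfl
    · exact ih.2 p hp

theorem mergeL_perm (l₁ : List (ℕ × P4)) : ∀ l₂, (mergeL l₁ l₂).Perm (l₁ ++ l₂) := by
  induction l₁ with
  | nil => intro l₂; exact List.Perm.refl _
  | cons a l₁ ih =>
    intro l₂
    induction l₂ with
    | nil => simp [mergeL]
    | cons b l₂ ih₂ =>
      have h : mergeL (a :: l₁) (b :: l₂) = bif Nat.ble a.1 b.1 then a :: mergeL l₁ (b :: l₂)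
        else b :: mergeL (a :: l₁) l₂ := rfl
      rw [h]
      cases Nat.ble a.1 b.1 with
      | true => exact (ih (b :: l₂)).cons a
      | false =>
        exact (ih₂.cons b).trans List.perm_middle.symm

theorem mergePairs_perm (L : List (List (ℕ × P4))) : ∀ o : Option (List (ℕ × P4)),
    (mergePairs L o).flatten.Perm (o.getD [] ++ L.flatten) := by
  induction L with
  | nil => intro o; cases o <;> simp [mergePairs]
  | cons b L ih =>
    intro o
    cases o with
    | none =>
      change (mergePairs L (some b)).flatten.Perm _
      simpa using ih (some b)
    | some a =>
      change (mergeL a b :: mergePairs L none).flatten.Perm _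
      have h1 := ih none
      simp only [List.flatten_cons, Option.getD_some, Option.getD_none, List.nil_append] at h1 ⊢
      rw [← List.append_assoc]
      exact (mergeL_perm a b).append h1

theorem mergeRounds_perm (n : ℕ) : ∀ L, (mergeRounds n L).flatten.Perm L.flatten := by
  induction n with
  | zero => intro L; exact List.Perm.refl _
  | succ n ih => intro L; exact (ih _).trans (by simpa using mergePairs_perm L none)

theorem stripKeys_spec (l : List (ℕ × P4)) : ∀ (n : ℕ) (out : List P4),
    stripKeys l n = some out → out = l.map Prod.snd ∧ (∀ p ∈ l, n < p.1) ∧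
      l.Pairwise (fun a b => a.1 < b.1) := by
  induction l with
  | nil =>
    intro n out h
    obtain rfl : [] = out := by simpa [stripKeys] using h
    simp
  | cons p l ih =>
    intro n out h
    obtain ⟨k, b⟩ := p
    have h' : (bif Nat.blt n k then
        Option.rec (motive := fun _ => Option (List P4)) none (fun l => some (b :: l))
          (stripKeys l k)
      else none) = some out := h
    cases hb : Nat.blt n k with
    | false => rw [hb] at h'; simp at h'
    | true =>
      rw [hb] at h'
      simp only [cond_true] at h'
      have hnk : n < k := by simpa [Nat.blt] using hb
      cases hs : stripKeys l k with
      | none => rw [hs] at h'; simp at h'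
      | some l' =>
        rw [hs] at h'
        obtain rfl : b :: l' = out := by simpa using h'
        obtain ⟨h1, h2, h3⟩ := ih k l' hs
        refine ⟨by simp [h1], ?_, List.pairwise_cons.2 ⟨fun p hp => h2 p hp, h3⟩⟩
        intro p hp
        rcases List.mem_cons.1 hp with rfl | hp
        · exact hnk
        · exact hnk.trans (h2 p hp)

theorem sortBy_spec {w : P4} {D D' : List P4} (h : sortBy w D = some D') :
    D'.Perm D ∧ D'.Pairwise (fun a b => wt w a < wt w b) := by
  unfold sortBy at h
  split at h
  · rename_i l hl
    obtain ⟨h1, _, h3⟩ := stripKeys_spec l 0 D' h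
    have hp := mergeRounds_perm 11 (decorate w D)
    rw [hl] at hp
    simp only [List.flatten_cons, List.flatten_nil, List.append_nil] at hp
    obtain ⟨h4, h5⟩ := decorate_spec w D
    constructor
    · rw [h1, ← h4]
      exact hp.map _
    · rw [h1, List.pairwise_map]
      refine h3.imp_of_mem ?_
      intro a b ha hb hab
      have e1 := h5 a (hp.subset ha)
      have e2 := h5 b (hp.subset hb)
      omega
  · simp at h

/-! ### The degeneration argument -/

/-- Evaluation of a monomial. -/
def mon (p : Fin 4 → ℚ) (β : P4) : ℚ := p 0 ^ β.x * p 1 ^ β.y * p 2 ^ β.z * p 3 ^ β.t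

/-- Products of falling factorials. -/
def desc (ν : Fin 4 → ℕ) (β : P4) : ℚ :=
  ((β.x.descFactorial (ν 0) * β.y.descFactorial (ν 1) * β.z.descFactorial (ν 2) *
    β.t.descFactorial (ν 3) : ℕ) : ℚ)

/-- The span of the falling factorials of order less than `m`. -/
def QQ (m : ℕ) : Submodule ℚ (P4 → ℚ) :=
  Submodule.span ℚ {f | ∃ ν : Fin 4 → ℕ, ∑ j, ν j < m ∧ f = desc ν}

/-- The linear functional `c ↦ ∑ β, c β * q β * p ^ β`. -/
noncomputable def LF (q : P4 → ℚ) (p : Fin 4 → ℚ) : (P4 →₀ ℚ) →ₗ[ℚ] ℚ :=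
  Finsupp.linearCombination ℚ (fun β => q β * mon p β)

/-- The vanishing conditions of order `m` at `p`. -/
def Cond (m : ℕ) (p : Fin 4 → ℚ) (c : P4 →₀ ℚ) : Prop := ∀ q ∈ QQ m, LF q p c = 0

theorem cond_of_desc {m : ℕ} {p : Fin 4 → ℚ} {c : P4 →₀ ℚ}
    (h : ∀ ν : Fin 4 → ℕ, ∑ j, ν j < m → LF (desc ν) p c = 0) : Cond m p c := by
  intro q hq
  unfold QQ at hq
  induction hq using Submodule.span_induction with
  | mem f hf => obtain ⟨ν, hν, rfl⟩ := hf; exact h ν hν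
  | zero => simp [LF, Finsupp.linearCombination_apply]
  | add f g _ _ hf hg =>
    simp only [LF, Finsupp.linearCombination_apply, Finsupp.sum] at hf hg ⊢
    simp only [Pi.add_apply, add_mul, smul_add, Finset.sum_add_distrib, hf, hg, add_zero]
  | smul a f _ hf =>
    simp only [LF, Finsupp.linearCombination_apply, Finsupp.sum, smul_eq_mul] at hf ⊢
    have : ∀ β, c β * ((a • f) β * mon p β) = a * (c β * (f β * mon p β)) := by
      intro β; simp only [Pi.smul_apply, smul_eq_mul]; ring
    simp only [this, ← Finset.mul_sum, hf, mul_zero]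

/-- The conditions at several points as a submodule. -/
def condSub (A B : List (Fin 4 → ℚ)) : Submodule ℚ (P4 →₀ ℚ) where
  carrier := {c | (∀ p ∈ A, Cond 4 p c) ∧ ∀ p ∈ B, Cond 3 p c}
  add_mem' := by
    intro c d hc hd
    exact ⟨fun p hp q hq => by rw [map_add, hc.1 p hp q hq, hd.1 p hp q hq, add_zero],
      fun p hp q hq => by rw [map_add, hc.2 p hp q hq, hd.2 p hp q hq, add_zero]⟩
  zero_mem' := ⟨fun p _ q _ => map_zero _, fun p _ q _ => map_zero _⟩
  smul_mem' := by
    intro a c hc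
    exact ⟨fun p hp q hq => by rw [map_smul, hc.1 p hp q hq, smul_zero],
      fun p hp q hq => by rw [map_smul, hc.2 p hp q hq, smul_zero]⟩

/-- The point of the monomial curve with weights `w` and parameter `u`. -/
def curve (w : P4) (u : ℚ) : Fin 4 → ℚ := ![u ^ w.x, u ^ w.y, u ^ w.z, u ^ w.t]

theorem mon_curve (w : P4) (u : ℚ) (β : P4) : mon (curve w u) β = u ^ wt w β := by
  have h : wt w β = w.x * β.x + w.y * β.y + (w.z * β.z + w.t * β.t) := rfl
  rw [h]
  simp only [mon, curve, Matrix.cons_val_zero, Matrix.cons_val_one, Matrix.cons_val]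
  simp only [← pow_mul, ← pow_add, add_assoc]

open scoped Polynomial in
/-- The key step: after removing `S`, generic points of the curve impose independent conditions. -/
theorem degeneration (W : P4 → ℕ) (D S : Finset P4) (hSD : S ⊆ D) (K : Submodule ℚ (P4 →₀ ℚ))
    (hK : ∀ c ∈ K, (∀ β, β ∉ D \ S → c β = 0) → c = 0)
    (q : P4 → P4 → ℚ) (hq : ∀ s ∈ S, q s s ≠ 0)
    (hqW : ∀ s ∈ S, ∀ β ∈ D, q s β ≠ 0 → β ≠ s → W s < W β) :
    ∃ F : ℚ[X], F ≠ 0 ∧ ∀ u : ℚ, u ≠ 0 → F.eval u ≠ 0 → ∀ c ∈ K, (∀ β, β ∉ D → c β = 0) →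
      (∀ s ∈ S, ∑ β ∈ D, c β * (q s β * u ^ W β) = 0) → c = 0 := by
  classical
  -- left inverse of the quotient map on vectors supported in `D \ S`
  let E := Finsupp.supported ℚ ℚ ((D \ S : Finset P4) : Set P4)
  let φ : E →ₗ[ℚ] ((P4 →₀ ℚ) ⧸ K) := K.mkQ ∘ₗ E.subtype
  have hφ : LinearMap.ker φ = ⊥ := by
    rw [LinearMap.ker_eq_bot']
    rintro ⟨c, hc⟩ h
    have hcK : c ∈ K := by simpa [φ] using h
    have : c = 0 := hK c hcK fun β hβ => by
      by_contra h0
      exact hβ (by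
        have := (Finsupp.mem_supported ℚ c).1 hc
        exact_mod_cast this (Finsupp.mem_support_iff.2 h0))
    simp [this]
  obtain ⟨B, hB⟩ := φ.exists_leftInverse_of_injective hφ
  have hB' : ∀ e : E, B (K.mkQ e) = e := fun e => by
    have := LinearMap.congr_fun hB e
    simpa [φ] using this
  let b : P4 → P4 → ℚ := fun α β => (B (K.mkQ (Finsupp.single β 1)) : P4 →₀ ℚ) α
  have hb : ∀ α β, β ∈ D \ S → b α β = if β = α then 1 else 0 := by
    intro α β hβ
    have hmem : Finsupp.single β (1 : ℚ) ∈ E :=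
      Finsupp.single_mem_supported ℚ _ (by exact_mod_cast hβ)
    have := hB' ⟨_, hmem⟩
    simp only [b]
    rw [this]
    simp [Finsupp.single_apply]
  let M : Matrix D D ℚ[X] := Matrix.of fun α β =>
    if (α : P4) ∈ S then (if W α ≤ W β then Polynomial.C (q α β) * Polynomial.X ^ (W β - W α) else 0) else Polynomial.C (b α β)
  have hM : ∀ (u : ℚ) (α β : D), (M.map (Polynomial.eval u)) α β =
      if (α : P4) ∈ S then (if W α ≤ W β then q α β * u ^ (W β - W α) else 0) else b α β := by
    intro u α β
    simp only [M, Matrix.map_apply, Matrix.of_apply]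
    split_ifs <;> simp
  have hdet : ∀ u, M.det.eval u = (M.map (Polynomial.eval u)).det := by
    intro u
    have := RingHom.map_det (Polynomial.evalRingHom u) M
    simpa [RingHom.mapMatrix_apply] using this
  have hW : ∀ s ∈ S, ∀ β ∈ D, ¬ W s ≤ W β → q s β = 0 := by
    intro s hs β hβ h
    by_contra h0
    by_cases hne : β = s
    · exact h (by rw [hne])
    · exact h (hqW s hs β hβ h0 hne).le
  refine ⟨M.det, ?_, ?_⟩
  · intro h0
    have h1 : (M.map (Polynomial.eval 0)).det = 0 := by rw [← hdet, h0, Polynomial.eval_zero]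
    obtain ⟨v, hv, hv0⟩ := Matrix.exists_mulVec_eq_zero_iff.2 h1
    apply hv
    have hrow : ∀ α : D, ∑ β, (M.map (Polynomial.eval 0)) α β * v β = 0 := fun α => by
      have := congrFun hv0 α
      simpa [Matrix.mulVec, dotProduct] using this
    have hS : ∀ α : D, (α : P4) ∈ S → v α = 0 := by
      intro α hα
      have h2 := hrow α
      rw [Finset.sum_eq_single α] at h2
      · rw [hM, if_pos hα, if_pos le_rfl] at h2
        simpa [hq α hα] using h2
      · intro β _ hne
        rw [hM, if_pos hα]
        split_ifs with hle
        · by_cases hq0 : q α β = 0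
          · simp [hq0]
          · have := hqW α hα β β.2 hq0 (fun h => hne (Subtype.ext h))
            rw [zero_pow (by omega)]; simp
        · simp
      · simp
    ext α
    by_cases hα : (α : P4) ∈ S
    · exact hS α hα
    · have h2 := hrow α
      rw [Finset.sum_eq_single α] at h2
      · rw [hM, if_neg hα, hb _ _ (Finset.mem_sdiff.2 ⟨α.2, hα⟩)] at h2
        simpa using h2
      · intro β _ hne
        by_cases hβ : (β : P4) ∈ S
        · rw [hS β hβ, mul_zero]
        · rw [hM, if_neg hα, hb _ _ (Finset.mem_sdiff.2 ⟨β.2, hβ⟩),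
            if_neg (fun h => hne (Subtype.ext h)), zero_mul]
      · simp
  · intro u hu hF c hcK hcD hc
    have hdu : (M.map (Polynomial.eval u)).det ≠ 0 := by rwa [← hdet]
    have hcsum : c = ∑ β : D, c β • Finsupp.single (β : P4) (1 : ℚ) := by
      rw [Finset.sum_coe_sort D (fun β => c β • Finsupp.single β (1 : ℚ))]
      ext γ
      rw [Finsupp.finsetSum_apply]
      simp only [Finsupp.smul_apply, Finsupp.single_apply, smul_eq_mul, mul_ite, mul_one, mul_zero]
      rw [Finset.sum_ite_eq']
      split_ifs with h
      · rfl
      · exact hcD γ h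
    have hv : (fun β : D => c β) = 0 := by
      by_contra hne
      apply hdu
      rw [← Matrix.exists_mulVec_eq_zero_iff]
      refine ⟨_, hne, ?_⟩
      ext α
      change ∑ β : D, (M.map (Polynomial.eval u)) α β * c β = 0
      by_cases hα : (α : P4) ∈ S
      · have h3 : ∀ β : D, (M.map (Polynomial.eval u)) α β * c β * u ^ W α = c β * (q α β * u ^ W β) := by
          intro β
          rw [hM, if_pos hα]
          split_ifs with hle
          · have : u ^ W β = u ^ (W β - W α) * u ^ W α := by
              rw [← pow_add, Nat.sub_add_cancel hle]
            rw [this]; ring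
          · rw [hW α hα β β.2 hle]; ring
        have h4 : (∑ β : D, (M.map (Polynomial.eval u)) α β * c β) * u ^ W α = 0 := by
          rw [Finset.sum_mul]
          simp only [h3]
          rw [Finset.sum_coe_sort D (fun β => c β * (q α β * u ^ W β))]
          exact hc α hα
        exact (mul_eq_zero.1 h4).resolve_right (pow_ne_zero _ hu)
      · have h5 : K.mkQ c = 0 := by simpa using hcK
        have h6 : (B (K.mkQ c) : P4 →₀ ℚ) α = 0 := by rw [h5, map_zero]; rfl
        rw [hcsum] at h6
        simp only [map_sum, map_smul, Submodule.coe_sum, Submodule.coe_smul,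
          Finsupp.finsetSum_apply, Finsupp.smul_apply, smul_eq_mul] at h6
        rw [← h6]
        refine Finset.sum_congr rfl fun β _ => ?_
        rw [hM, if_neg hα, mul_comm]
    ext γ
    by_cases hγ : γ ∈ D
    · exact congrFun hv ⟨γ, hγ⟩
    · exact hcD γ hγ

/-- There are `a` quadruple and `b` triple points imposing independent conditions on the
polynomials with exponents in `D`. -/
def GoodAB (D : Finset P4) (a b : ℕ) : Prop :=
  ∃ A B : List (Fin 4 → ℚ), A.length = a ∧ B.length = b ∧ (∀ p ∈ A ++ B, ∀ i, p i ≠ 0) ∧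
    (A ++ B).Pairwise (fun p p' => p 0 * p' 1 ≠ p 1 * p' 0) ∧
    ∀ c ∈ condSub A B, (∀ β, β ∉ D → c β = 0) → c = 0

theorem goodAB_empty : GoodAB ∅ 0 0 :=
  ⟨[], [], rfl, rfl, by simp, by simp, fun c _ h => Finsupp.ext fun β => h β (by simp)⟩

open scoped Polynomial in
/-- Choice of a general point on a monomial curve. -/
theorem exists_general (w : P4) (hw : w.x ≠ w.y) (F : ℚ[X]) (hF : F ≠ 0)
    (L : List (Fin 4 → ℚ)) (hL : ∀ p ∈ L, ∀ i, p i ≠ 0) :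
    ∃ u : ℚ, u ≠ 0 ∧ F.eval u ≠ 0 ∧ ∀ p ∈ L, curve w u 0 * p 1 ≠ curve w u 1 * p 0 := by
  let G : ℚ[X] := (L.map fun p => Polynomial.C (p 1) * Polynomial.X ^ w.x - Polynomial.C (p 0) * Polynomial.X ^ w.y).prod
  have hG : G ≠ 0 := by
    apply List.prod_ne_zero
    intro h
    obtain ⟨p, hp, h0⟩ := List.mem_map.1 h
    have h1 := congrArg (fun f => Polynomial.coeff f w.x) h0
    simp [Polynomial.coeff_X_pow, hw] at h1
    exact hL p hp 1 h1
  have hne : Polynomial.X * F * G ≠ 0 := mul_ne_zero (mul_ne_zero Polynomial.X_ne_zero hF) hG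
  obtain ⟨u, hu⟩ : ∃ u : ℚ, (Polynomial.X * F * G).eval u ≠ 0 := by
    by_contra! h
    exact hne (Polynomial.funext fun u => by simp [h u])
  simp only [Polynomial.eval_mul, Polynomial.eval_X, mul_ne_zero_iff] at hu
  refine ⟨u, hu.1.1, hu.1.2, fun p hp h => hu.2 ?_⟩
  simp only [G, Polynomial.eval_list_prod]
  rw [List.prod_eq_zero_iff]
  refine List.mem_map.2 ⟨_, List.mem_map.2 ⟨p, hp, rfl⟩, ?_⟩
  simp only [curve, Matrix.cons_val_zero, Matrix.cons_val_one] at h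
  simp only [Polynomial.eval_sub, Polynomial.eval_mul, Polynomial.eval_C, Polynomial.eval_pow, Polynomial.eval_X]
  linear_combination h

theorem LF_curve (w : P4) (u : ℚ) (q : P4 → ℚ) (D : Finset P4) (c : P4 →₀ ℚ)
    (hc : ∀ β, β ∉ D → c β = 0) :
    LF q (curve w u) c = ∑ β ∈ D, c β * (q β * u ^ wt w β) := by
  rw [LF, Finsupp.linearCombination_apply, Finsupp.sum_of_support_subset (s := D)]
  · simp only [mon_curve, smul_eq_mul]
  · intro β hβ
    by_contra h
    exact (Finsupp.mem_support_iff.1 hβ) (hc β h)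
  · simp

theorem curve_ne_zero (w : P4) {u : ℚ} (hu : u ≠ 0) : ∀ i, curve w u i ≠ 0 := by
  intro i
  fin_cases i <;> simp [curve, hu]

/-- The general step, for either multiplicity. -/
theorem general_step {m : ℕ} {w : P4} (hw : w.x ≠ w.y) {P P' : List P4}
    (hr : Removes (QQ m) (wt w) P P') (A B : List (Fin 4 → ℚ))
    (hne : ∀ p ∈ A ++ B, ∀ i, p i ≠ 0)
    (hK : ∀ c ∈ condSub A B, (∀ β, β ∉ P'.toFinset → c β = 0) → c = 0) :
    ∃ p : Fin 4 → ℚ, (∀ i, p i ≠ 0) ∧ (∀ p' ∈ A ++ B, p 0 * p' 1 ≠ p 1 * p' 0) ∧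
      ∀ c ∈ condSub A B, Cond m p c → (∀ β, β ∉ P.toFinset → c β = 0) → c = 0 := by
  classical
  obtain ⟨hsub, hrem⟩ := hr
  let D := P.toFinset
  let S := D \ P'.toFinset
  have hrem' : ∀ s : P4, ∃ q ∈ QQ m, s ∈ S → q s ≠ 0 ∧
      ∀ β ∈ P, q β ≠ 0 → β ≠ s → wt w s < wt w β := by
    intro s
    by_cases hs : s ∈ S
    · have hs' := Finset.mem_sdiff.1 hs
      obtain ⟨q, hq, h⟩ := hrem s (List.mem_toFinset.1 hs'.1)
        (fun h => hs'.2 (List.mem_toFinset.2 h))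
      exact ⟨q, hq, fun _ => h⟩
    · exact ⟨0, Submodule.zero_mem _, fun h => absurd h hs⟩
  choose q hqQ hq using hrem'
  have hDS : ∀ β, β ∉ P'.toFinset → β ∉ D \ S := by
    intro β hβ h
    obtain ⟨h1, h2⟩ := Finset.mem_sdiff.1 h
    exact h2 (Finset.mem_sdiff.2 ⟨h1, hβ⟩)
  obtain ⟨F, hF, hmain⟩ := degeneration (wt w) D S Finset.sdiff_subset (condSub A B)
    (fun c hc h => hK c hc fun β hβ => h β (hDS β hβ)) q (fun s hs => (hq s hs).1)
    (fun s hs β hβ => (hq s hs).2 β (List.mem_toFinset.1 hβ))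
  obtain ⟨u, hu, hFu, hind⟩ := exists_general w hw F hF (A ++ B) hne
  refine ⟨curve w u, curve_ne_zero w hu, hind, fun c hc hcond hcD => ?_⟩
  refine hmain u hu hFu c hc hcD fun s hs => ?_
  rw [← LF_curve w u (q s) D c hcD]
  exact hcond (q s) (hqQ s)

theorem step_cubic {w : P4} (hw : w.x ≠ w.y) {P P' : List P4}
    (hr : Removes (QQ 4) (wt w) P P') {a b : ℕ} (h : GoodAB P'.toFinset a b) :
    GoodAB P.toFinset (a + 1) b := by
  obtain ⟨A, B, rfl, rfl, hne, hpw, hK⟩ := h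
  obtain ⟨p, hp, hind, hc⟩ := general_step hw hr A B hne hK
  refine ⟨p :: A, B, by simp, rfl, ?_, ?_, ?_⟩
  · intro p' hp'
    rcases List.mem_cons.1 hp' with rfl | hp'
    · exact hp
    · exact hne p' hp'
  · exact List.pairwise_cons.2 ⟨hind, hpw⟩
  · intro c hcs
    exact hc c ⟨fun p' hp' => hcs.1 p' (List.mem_cons_of_mem _ hp'), hcs.2⟩
      (hcs.1 p List.mem_cons_self)

theorem step_quad {w : P4} (hw : w.x ≠ w.y) {P P' : List P4}
    (hr : Removes (QQ 3) (wt w) P P') {a b : ℕ} (h : GoodAB P'.toFinset a b) :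
    GoodAB P.toFinset a (b + 1) := by
  obtain ⟨A, B, rfl, rfl, hne, hpw, hK⟩ := h
  obtain ⟨p, hp, hind, hc⟩ := general_step hw hr A B hne hK
  refine ⟨A, p :: B, rfl, by simp, ?_, ?_, ?_⟩
  · intro p' hp'
    rcases List.mem_cons.1 (List.perm_middle.subset hp') with rfl | hp'
    · exact hp
    · exact hne p' hp'
  · rw [List.pairwise_middle]
    · exact List.pairwise_cons.2 ⟨hind, hpw⟩
    · intro x y hxy h
      exact hxy (by linear_combination -h)
  · intro c hcs
    exact hc c ⟨hcs.1, fun p' hp' => hcs.2 p' (List.mem_cons_of_mem _ hp')⟩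
      (hcs.2 p List.mem_cons_self)

/-! ### Soundness of the certificate checker -/

/-- All exponents are at most 17. -/
def Box (P : List P4) : Prop := ∀ β ∈ P, β.x ≤ 17 ∧ β.y ≤ 17 ∧ β.z ≤ 17

theorem desc_mem {m : ℕ} (ν : Fin 4 → ℕ) (hν : ∑ j, ν j < m) (f : P4 → ℕ)
    (hf : ∀ β : P4, f β = β.x.descFactorial (ν 0) * β.y.descFactorial (ν 1) *
      β.z.descFactorial (ν 2) * β.t.descFactorial (ν 3)) : (fun β => (f β : ℚ)) ∈ QQ m := by
  apply Submodule.subset_span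
  exact ⟨ν, hν, funext fun β => by rw [hf β]; rfl⟩

theorem bound3 {a b c : ℕ} (ha : a ≤ 17) (hb : b ≤ 17) (hc : c ≤ 17) : a * b * c ≤ 5000 :=
  (Nat.mul_le_mul (Nat.mul_le_mul ha hb) hc).trans (by norm_num)

theorem bound2 {a b : ℕ} (ha : a ≤ 17) (hb : b ≤ 17) : a * b ≤ 5000 :=
  (Nat.mul_le_mul ha hb).trans (by norm_num)

theorem famOK_fs3 {m : ℕ} (hm : 3 ≤ m) {P : List P4} (hP : Box P) : FamOK (QQ m) P fs3 := by
  intro f hf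
  simp only [fs3, List.mem_cons, List.not_mem_nil, or_false] at hf
  rcases hf with rfl | rfl | rfl | rfl | rfl | rfl | rfl | rfl | rfl | rfl
  · exact ⟨desc_mem ![0, 0, 0, 0] (by simp [Fin.sum_univ_four]; omega) _ (fun β => by simp),
      fun β hβ => by norm_num⟩
  · exact ⟨desc_mem ![1, 0, 0, 0] (by simp [Fin.sum_univ_four]; omega) _ (fun β => by simp),
      fun β hβ => by have := hP β hβ; dsimp only; omega⟩
  · exact ⟨desc_mem ![0, 1, 0, 0] (by simp [Fin.sum_univ_four]; omega) _ (fun β => by simp),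
      fun β hβ => by have := hP β hβ; dsimp only; omega⟩
  · exact ⟨desc_mem ![0, 0, 1, 0] (by simp [Fin.sum_univ_four]; omega) _ (fun β => by simp),
      fun β hβ => by have := hP β hβ; dsimp only; omega⟩
  · exact ⟨desc_mem ![2, 0, 0, 0] (by simp [Fin.sum_univ_four]; omega) _
      (fun β => by simp [Nat.descFactorial]; ring),
      fun β hβ => bound2 (by have := hP β hβ; omega) (by have := hP β hβ; simp; omega)⟩
  · exact ⟨desc_mem ![0, 2, 0, 0] (by simp [Fin.sum_univ_four]; omega) _
      (fun β => by simp [Nat.descFactorial]; ring),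
      fun β hβ => bound2 (by have := hP β hβ; omega) (by have := hP β hβ; simp; omega)⟩
  · exact ⟨desc_mem ![0, 0, 2, 0] (by simp [Fin.sum_univ_four]; omega) _
      (fun β => by simp [Nat.descFactorial]; ring),
      fun β hβ => bound2 (by have := hP β hβ; omega) (by have := hP β hβ; simp; omega)⟩
  · exact ⟨desc_mem ![1, 1, 0, 0] (by simp [Fin.sum_univ_four]; omega) _ (fun β => by simp),
      fun β hβ => bound2 (by have := hP β hβ; omega) (by have := hP β hβ; omega)⟩
  · exact ⟨desc_mem ![1, 0, 1, 0] (by simp [Fin.sum_univ_four]; omega) _ (fun β => by simp),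
      fun β hβ => bound2 (by have := hP β hβ; omega) (by have := hP β hβ; omega)⟩
  · exact ⟨desc_mem ![0, 1, 1, 0] (by simp [Fin.sum_univ_four]; omega) _ (fun β => by simp),
      fun β hβ => bound2 (by have := hP β hβ; omega) (by have := hP β hβ; omega)⟩

theorem famOK_fsNew {P : List P4} (hP : Box P) : FamOK (QQ 4) P fsNew := by
  intro f hf
  have hb : ∀ β ∈ P, f β ≤ 5000 := by
    intro β hβ
    obtain ⟨h1, h2, h3⟩ := hP β hβ
    have h1' : ∀ k, Nat.sub β.x k ≤ 17 := fun k => (Nat.sub_le _ _).trans h1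
    have h2' : ∀ k, Nat.sub β.y k ≤ 17 := fun k => (Nat.sub_le _ _).trans h2
    have h3' : ∀ k, Nat.sub β.z k ≤ 17 := fun k => (Nat.sub_le _ _).trans h3
    simp only [fsNew, List.mem_cons, List.not_mem_nil, or_false] at hf
    rcases hf with rfl | rfl | rfl | rfl | rfl | rfl | rfl | rfl | rfl | rfl <;>
      exact bound3 (by first | assumption | apply_assumption) (by first | assumption | apply_assumption)
        (by first | assumption | apply_assumption)
  refine ⟨?_, hb⟩
  simp only [fsNew, List.mem_cons, List.not_mem_nil, or_false] at hf
  rcases hf with rfl | rfl | rfl | rfl | rfl | rfl | rfl | rfl | rfl | rfl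
  · exact desc_mem ![3, 0, 0, 0] (by decide) _ (fun β => by simp [Nat.descFactorial]; ring)
  · exact desc_mem ![0, 3, 0, 0] (by decide) _ (fun β => by simp [Nat.descFactorial]; ring)
  · exact desc_mem ![0, 0, 3, 0] (by decide) _ (fun β => by simp [Nat.descFactorial]; ring)
  · exact desc_mem ![2, 1, 0, 0] (by decide) _ (fun β => by simp [Nat.descFactorial]; left; ring)
  · exact desc_mem ![2, 0, 1, 0] (by decide) _ (fun β => by simp [Nat.descFactorial]; left; ring)
  · exact desc_mem ![1, 2, 0, 0] (by decide) _ (fun β => by simp [Nat.descFactorial]; ring)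
  · exact desc_mem ![0, 2, 1, 0] (by decide) _ (fun β => by simp [Nat.descFactorial]; left; ring)
  · exact desc_mem ![1, 0, 2, 0] (by decide) _ (fun β => by simp [Nat.descFactorial]; ring)
  · exact desc_mem ![0, 1, 2, 0] (by decide) _ (fun β => by simp [Nat.descFactorial]; ring)
  · exact desc_mem ![1, 1, 1, 0] (by decide) _ (fun β => by simp)

theorem famOK_fs4 {P : List P4} (hP : Box P) : FamOK (QQ 4) P fs4 := by
  intro f hf
  rcases List.mem_append.1 hf with hf | hf
  · exact famOK_fs3 (by norm_num) hP f hf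
  · exact famOK_fsNew hP f hf

theorem runSide_spec {Q : Submodule ℚ (P4 → ℚ)} {fs : List (P4 → ℕ)} {n k : ℕ} {w : P4}
    {D out : List P4} (hfs : ∀ P, Box P → FamOK Q P fs) (hD : Box D)
    (h : runSide fs n k w D = some out) (G : ℕ → Finset P4 → Prop)
    (hG : w.x ≠ w.y → ∀ k P P', Removes Q (wt w) P P' → G k P'.toFinset → G (k + 1) P.toFinset) :
    Box out ∧ (G 0 out.toFinset → G k D.toFinset) := by
  unfold runSide at h
  rcases hb : Nat.beq w.x w.y with _ | _
  · rw [hb] at h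
    have hw : w.x ≠ w.y := fun he => by rw [he, Nat.beq_refl] at hb; exact Bool.noConfusion hb
    simp only [cond_false] at h
    split at h
    · simp at h
    · rename_i D' hD'
      obtain ⟨hperm, hpw⟩ := sortBy_spec hD'
      have hbox : Box D' := fun β hβ => hD β (hperm.subset hβ)
      have hsub : ∀ β ∈ out, β ∈ D' :=
        chain_spec (Q := Q) (W := wt w) (fun _ P => ∀ β ∈ out, β ∈ P)
          (fun k P P' _ hr hi β hβ => hr.1.subset (hi β hβ)) k D' out (hfs D' hbox) hpw h
          (fun β hβ => hβ)
      refine ⟨fun β hβ => hbox β (hsub β hβ), fun h0 => ?_⟩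
      have := chain_spec (Q := Q) (W := wt w) (fun k P => G k P.toFinset)
        (fun k P P' _ hr hi => hG hw k P P' hr hi) k D' out (hfs D' hbox) hpw h h0
      rwa [List.toFinset_eq_of_perm _ _ hperm] at this
  · rw [hb] at h
    simp at h

/-- The pairs `(a, b)` covered by a certificate. -/
def pairs : List ℕ → List (ℕ × ℕ)
  | [] => [(0, 0)]
  | k :: ks => (pairs ks).map (fun p => (p.1 + k, p.2)) ++ (pairs ks).map (fun p => (p.1, p.2 + 2 * k))

theorem checkTree_spec (t : CTree) : ∀ (ks : List ℕ) (D : List P4), checkTree t ks D = true →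
    Box D → ∀ p ∈ pairs ks, GoodAB D.toFinset p.1 p.2 := by
  induction t with
  | leaf =>
    intro ks D h _ p hp
    match ks, D with
    | [], [] =>
      simp only [pairs, List.mem_singleton] at hp
      subst hp
      exact goodAB_empty
    | [], _ :: _ => simp [checkTree] at h
    | _ :: _, _ => simp [checkTree] at h
  | node wc c wq q ihc ihq =>
    intro ks D h hD p hp
    match ks with
    | [] => simp [checkTree] at h
    | k :: ks =>
      simp only [checkTree, Bool.and_eq_true] at h
      obtain ⟨h1, h2⟩ := h
      simp only [pairs, List.mem_append, List.mem_map] at hp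
      rcases hp with ⟨⟨a, b⟩, hab, rfl⟩ | ⟨⟨a, b⟩, hab, rfl⟩
      · split at h1
        · simp at h1
        · rename_i D' hD'
          obtain ⟨hb, hg⟩ := runSide_spec (Q := QQ 4) (fun P hP => famOK_fs4 hP) hD hD'
            (fun k S => GoodAB S (a + k) b) (fun hw k P P' hr hi => step_cubic hw hr hi)
          exact hg (ihc ks D' h1 hb (a, b) hab)
      · split at h2
        · simp at h2
        · rename_i D' hD'
          obtain ⟨hb, hg⟩ := runSide_spec (Q := QQ 3) (fun P hP => famOK_fs3 le_rfl hP) hD hD'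
            (fun k S => GoodAB S a (b + k)) (fun hw k P P' hr hi => step_quad hw hr hi)
          exact hg (ihq ks D' h2 hb (a, b) hab)

theorem mem_lineZ (x y s n : ℕ) (acc : List P4) (β : P4) :
    β ∈ lineZ x y s n acc ↔ (β.x = x ∧ β.y = y ∧ β.z ≤ n ∧ β.t = s - β.z) ∨ β ∈ acc := by
  induction n with
  | zero =>
    change β ∈ (⟨x, y, 0, s⟩ : P4) :: acc ↔ _
    obtain ⟨a, b, c, d⟩ := β
    simp only [List.mem_cons, P4.mk.injEq]
    refine or_congr_left ⟨?_, ?_⟩ <;> omega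
  | succ n ih =>
    have h : lineZ x y s (n + 1) acc = (⟨x, y, n + 1, s - (n + 1)⟩ : P4) :: lineZ x y s n acc := by
      change (forceNat (Nat.sub s (Nat.succ n)) fun t => forceNat (Nat.succ n) fun z' =>
        (⟨x, y, z', t⟩ : P4) :: lineZ x y s n acc) = _
      rw [forceNat_eq, forceNat_eq]; rfl
    rw [h, List.mem_cons, ih, ← or_assoc]
    obtain ⟨a, b, c, d⟩ := β
    simp only [P4.mk.injEq]
    refine or_congr_left ⟨?_, ?_⟩ <;> omega

theorem mem_planeY (x s n : ℕ) (acc : List P4) (β : P4) :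
    β ∈ planeY x s n acc ↔
      (β.x = x ∧ β.y ≤ n ∧ β.z ≤ s - β.y ∧ β.t = s - β.y - β.z) ∨ β ∈ acc := by
  induction n with
  | zero =>
    change β ∈ lineZ x 0 s s acc ↔ _
    rw [mem_lineZ]
    refine or_congr_left ⟨?_, ?_⟩ <;> rintro ⟨h1, h2, h3, h4⟩ <;> refine ⟨h1, ?_, ?_, ?_⟩ <;> omega
  | succ n ih =>
    have h : planeY x s (n + 1) acc = lineZ x (n + 1) (s - (n + 1)) (s - (n + 1))
        (planeY x s n acc) := by
      change (forceNat (Nat.sub s (Nat.succ n)) fun t => forceNat (Nat.succ n) fun y' =>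
        lineZ x y' t t (planeY x s n acc)) = _
      rw [forceNat_eq, forceNat_eq]; rfl
    rw [h, mem_lineZ, ih, ← or_assoc]
    refine or_congr_left ⟨?_, ?_⟩ <;> omega

theorem mem_spaceX (s n : ℕ) (β : P4) :
    β ∈ spaceX s n ↔
      β.x ≤ n ∧ β.y ≤ s - β.x ∧ β.z ≤ s - β.x - β.y ∧ β.t = s - β.x - β.y - β.z := by
  induction n with
  | zero =>
    change β ∈ planeY 0 s s [] ↔ _
    rw [mem_planeY]
    simp only [List.not_mem_nil, or_false]
    omega
  | succ n ih =>
    have h : spaceX s (n + 1) = planeY (n + 1) (s - (n + 1)) (s - (n + 1)) (spaceX s n) := by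
      change (forceNat (Nat.sub s (Nat.succ n)) fun t => forceNat (Nat.succ n) fun x' =>
        planeY x' t t (spaceX s n)) = _
      rw [forceNat_eq, forceNat_eq]; rfl
    rw [h, mem_planeY, ih]
    omega

theorem mem_fullD (β : P4) (h : β.x + β.y + β.z + β.t = 17) : β ∈ fullD := by
  rw [fullD, mem_spaceX]; omega

theorem box_fullD : Box fullD := by
  intro β hβ
  rw [fullD, mem_spaceX] at hβ
  omega

set_option maxRecDepth 100000 in
theorem certTree_ok : checkTree certTree [29, 14, 7, 4, 2, 1] fullD = true := by
  decide +kernel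

theorem pairs_mem : ∀ a < 58, (a, 114 - 2 * a) ∈ pairs [29, 14, 7, 4, 2, 1] := by
  decide +kernel

theorem good_pairs (a b : ℕ) (hab : 2 * a + b = 114) : GoodAB fullD.toFinset a b := by
  obtain rfl : b = 114 - 2 * a := by omega
  exact checkTree_spec certTree _ _ certTree_ok box_fullD (a, 114 - 2 * a)
    (pairs_mem a (by omega))

/-! ### From polynomials to coefficient vectors -/

/-- Exponent vectors as finitely supported functions. -/
def toP4 (s : Fin 4 →₀ ℕ) : P4 := ⟨s 0, s 1, s 2, s 3⟩

theorem toP4_injective : Function.Injective toP4 := by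
  intro s t h
  simp only [toP4, P4.mk.injEq] at h
  ext i
  fin_cases i
  · exact h.1
  · exact h.2.1
  · exact h.2.2.1
  · exact h.2.2.2

theorem pderiv_pow_monomial (i : Fin 4) (n : ℕ) (s : Fin 4 →₀ ℕ) (a : ℚ) :
    ((MvPolynomial.pderiv i).toLinearMap ^ n : Module.End ℚ (MvPolynomial (Fin 4) ℚ))
      (MvPolynomial.monomial s a) =
      MvPolynomial.monomial (s - Finsupp.single i n) (a * ((s i).descFactorial n : ℕ)) := by
  induction n with
  | zero => simp
  | succ n ih =>
    rw [pow_succ', Module.End.mul_apply, ih]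
    change MvPolynomial.pderiv i _ = _
    rw [MvPolynomial.pderiv_monomial]
    have h1 : s - Finsupp.single i n - Finsupp.single i 1 = s - Finsupp.single i (n + 1) := by
      rw [tsub_tsub, ← Finsupp.single_add]
    rw [h1]
    congr 1
    rw [Nat.descFactorial_succ, Finsupp.tsub_apply, Finsupp.single_eq_same]
    push_cast
    ring

/-- The evaluation of a derivative of a monomial. -/
theorem aeval_diffOp_monomial (ν : Fin 4 → ℕ) (p : Fin 4 → ℚ) (s : Fin 4 →₀ ℕ) (a : ℚ) :
    MvPolynomial.aeval p (diffOp ν (MvPolynomial.monomial s a)) *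
      (p 0 ^ ν 0 * p 1 ^ ν 1 * p 2 ^ ν 2 * p 3 ^ ν 3) =
      a * (desc ν (toP4 s) * mon p (toP4 s)) := by
  simp only [diffOp, Module.End.mul_apply, pderiv_pow_monomial]
  rw [MvPolynomial.aeval_monomial, Finsupp.prod_fintype _ _ (by simp), Fin.prod_univ_four]
  simp only [Finsupp.tsub_apply, Finsupp.single_apply, desc, mon, toP4]
  simp only [reduceIte, Fin.reduceEq, tsub_zero]
  have key : ∀ (x : ℚ) (m n : ℕ), (m.descFactorial n : ℚ) * (x ^ (m - n) * x ^ n) =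
      (m.descFactorial n : ℚ) * x ^ m := by
    intro x m n
    rcases le_or_gt n m with h | h
    · rw [← pow_add, Nat.sub_add_cancel h]
    · rw [Nat.descFactorial_eq_zero_iff_lt.2 h]; simp
  have k0 := key (p 0) (s 0) (ν 0)
  have k1 := key (p 1) (s 1) (ν 1)
  have k2 := key (p 2) (s 2) (ν 2)
  have k3 := key (p 3) (s 3) (ν 3)
  rw [eq_ratCast, Rat.cast_id]
  push_cast
  calc _ = a * ((((s 0).descFactorial (ν 0) : ℚ) * (p 0 ^ (s 0 - ν 0) * p 0 ^ ν 0)) *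
      (((s 1).descFactorial (ν 1) : ℚ) * (p 1 ^ (s 1 - ν 1) * p 1 ^ ν 1)) *
      (((s 2).descFactorial (ν 2) : ℚ) * (p 2 ^ (s 2 - ν 2) * p 2 ^ ν 2)) *
      (((s 3).descFactorial (ν 3) : ℚ) * (p 3 ^ (s 3 - ν 3) * p 3 ^ ν 3))) := by ring
    _ = _ := by rw [k0, k1, k2, k3]; ring

/-- The coefficient vector of a polynomial. -/
noncomputable def coeffVec (f : MvPolynomial (Fin 4) ℚ) : P4 →₀ ℚ :=
  ∑ s ∈ f.support, Finsupp.single (toP4 s) (f.coeff s)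

theorem coeffVec_toP4 (f : MvPolynomial (Fin 4) ℚ) (s : Fin 4 →₀ ℕ) :
    coeffVec f (toP4 s) = f.coeff s := by
  classical
  rw [coeffVec, Finsupp.finsetSum_apply]
  simp only [Finsupp.single_apply, toP4_injective.eq_iff]
  rw [Finset.sum_ite_eq']
  split_ifs with h
  · rfl
  · exact (MvPolynomial.notMem_support_iff.1 h).symm

theorem LF_coeffVec (ν : Fin 4 → ℕ) (p : Fin 4 → ℚ) (f : MvPolynomial (Fin 4) ℚ) :
    LF (desc ν) p (coeffVec f) = MvPolynomial.aeval p (diffOp ν f) *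
      (p 0 ^ ν 0 * p 1 ^ ν 1 * p 2 ^ ν 2 * p 3 ^ ν 3) := by
  conv_rhs => rw [f.as_sum]
  rw [map_sum, map_sum, Finset.sum_mul, coeffVec, map_sum]
  refine Finset.sum_congr rfl fun s _ => ?_
  rw [aeval_diffOp_monomial, LF, Finsupp.linearCombination_single, smul_eq_mul]

theorem cond_of_mem {m : ℕ} {p : Fin 4 → ℚ} {f : MvPolynomial (Fin 4) ℚ}
    (h : f ∈ vanishingSpace m p) : Cond m p (coeffVec f) := by
  refine cond_of_desc fun ν hν => ?_
  have h1 : MvPolynomial.aeval p (diffOp ν f) = 0 := by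
    simp only [vanishingSpace, Submodule.mem_iInf] at h
    exact h ν hν
  rw [LF_coeffVec, h1, zero_mul]

theorem coeffVec_homogeneous {f : MvPolynomial (Fin 4) ℚ} (hf : f.IsHomogeneous 17) (β : P4)
    (hβ : β ∉ fullD.toFinset) : coeffVec f β = 0 := by
  classical
  rw [coeffVec, Finsupp.finsetSum_apply]
  refine Finset.sum_eq_zero fun s hs => ?_
  rw [Finsupp.single_apply, if_neg]
  rintro rfl
  apply hβ
  rw [List.mem_toFinset]
  apply mem_fullD
  have h1 := hf (MvPolynomial.mem_support_iff.1 hs)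
  rw [Finsupp.weight_apply, Finsupp.sum_fintype _ _ (by simp), Fin.sum_univ_four] at h1
  simpa [toP4] using h1

theorem linearIndependent_of_ne {p p' : Fin 4 → ℚ} (h : p 0 * p' 1 ≠ p 1 * p' 0) :
    LinearIndependent ℚ ![p, p'] := by
  rw [LinearIndependent.pair_iff]
  intro s t hst
  have h0 : s * p 0 + t * p' 0 = 0 := by simpa using congrFun hst 0
  have h1 : s * p 1 + t * p' 1 = 0 := by simpa using congrFun hst 1
  have hd : p 0 * p' 1 - p 1 * p' 0 ≠ 0 := sub_ne_zero.2 h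
  constructor
  · refine (mul_eq_zero.1 (?_ : s * (p 0 * p' 1 - p 1 * p' 0) = 0)).resolve_right hd
    linear_combination p' 1 * h0 - p' 0 * h1
  · refine (mul_eq_zero.1 (?_ : t * (p 0 * p' 1 - p 1 * p' 0) = 0)).resolve_right hd
    linear_combination p 0 * h1 - p 1 * h0

theorem vdim_seventeen (a b : ℕ) (hab : 2 * a + b = 114) :
    vdim 17 (List.replicate a 4 ++ List.replicate b 3) = -1 := by
  have h1 : (20 : ℕ).choose 3 = 1140 := by decide
  have h2 : (6 : ℕ).choose 3 = 20 := by decide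
  have h3 : (5 : ℕ).choose 3 = 10 := by decide
  simp only [vdim, List.map_append, List.map_replicate, List.sum_append, List.sum_replicate,
    Nat.reduceAdd, h1, h2, h3, nsmul_eq_mul]
  push_cast
  omega

/-- `L_3(17; 4^{×a}, 3^{×b})` with `2a + b = 114` is non-special of virtual dimension `−1`. -/
theorem nonSpecial_seventeen (a b : ℕ) (hab : 2 * a + b = 114) :
    nonSpecial 17 (List.replicate a 4 ++ List.replicate b 3) ∧
      vdim 17 (List.replicate a 4 ++ List.replicate b 3) = -1 := by
  refine ⟨?_, vdim_seventeen a b hab⟩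
  obtain ⟨A, B, hA, hB, hne, hpw, hK⟩ := good_pairs a b hab
  have hlen : (List.replicate a 4 ++ List.replicate b 3).length = (A ++ B).length := by
    simp [hA, hB]
  refine ⟨fun i => (A ++ B).get (Fin.cast hlen i), fun i h => ?_, fun i j hij => ?_, ?_⟩
  · exact hne _ (List.get_mem _ _) 0 (congrFun h 0)
  · apply linearIndependent_of_ne
    have hij' : (i : ℕ) ≠ j := fun h => hij (Fin.ext h)
    rw [List.pairwise_iff_get] at hpw
    rcases lt_or_gt_of_ne hij' with h | h
    · exact hpw (Fin.cast hlen i) (Fin.cast hlen j) h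
    · intro he
      exact hpw (Fin.cast hlen j) (Fin.cast hlen i) h (by linear_combination -he)
  · rw [vdim_seventeen a b hab]
    have hbot : systemSpace 17 (List.replicate a 4 ++ List.replicate b 3)
        (fun i => (A ++ B).get (Fin.cast hlen i)) = ⊥ := by
      rw [Submodule.eq_bot_iff]
      intro f hf
      obtain ⟨hf1, hf2⟩ := Submodule.mem_inf.1 hf
      rw [Submodule.mem_iInf] at hf2
      have hc : coeffVec f = 0 := by
        refine hK _ ⟨fun p hp => ?_, fun p hp => ?_⟩
          (coeffVec_homogeneous ((MvPolynomial.mem_homogeneousSubmodule 17 f).1 hf1))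
        · obtain ⟨n, hn, rfl⟩ := List.getElem_of_mem hp
          have h1 := hf2 ⟨n, by simp; omega⟩
          simp only [List.get_eq_getElem, Fin.val_cast] at h1
          rw [List.getElem_append_left hn, List.getElem_append_left (by simp; omega),
            List.getElem_replicate] at h1
          exact cond_of_mem h1
        · obtain ⟨n, hn, rfl⟩ := List.getElem_of_mem hp
          have h1 := hf2 ⟨a + n, by simp; omega⟩
          simp only [List.get_eq_getElem, Fin.val_cast] at h1
          rw [List.getElem_append_right (by simp), List.getElem_append_right (by omega),
            List.getElem_replicate] at h1
          simp only [hA, Nat.add_sub_cancel_left] at h1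
          exact cond_of_mem h1
      ext s
      rw [← coeffVec_toP4, hc]
      simp
    rw [hbot]
    simp
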